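/- arXiv:1305.7376 — 4 statements merged into one kernel-verified Lean document; each statement's English description precedes it below -/
import Mathlib

section
/- For every integer t ≥ 2, every finite graph G with average degree at least 648 · t · √(log t) contains the complete graph K_t as a minor. -/
open SimpleGraph

/-- A minor model of `H` in `G`: pairwise disjoint branch sets `B v ⊆ V(G)`, each
inducing a connected (hence nonempty) subgraph of `G`, such that for every edge
`{u,v}` of `H` there is an edge of `G` between `B u` and `B v`. -/
def IsMinorModel {β α : Type*} (H : SimpleGraph β) (G : SimpleGraph α)
    (B : β → Set α) : Prop :=
  (∀ u, (G.induce (B u)).Connected) ∧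
  (Pairwise fun u v => Disjoint (B u) (B v)) ∧
  (∀ u v, H.Adj u v → ∃ a ∈ B u, ∃ b ∈ B v, G.Adj a b)

/-- `H` is a minor of `G`. -/
def IsMinor {β α : Type*} (H : SimpleGraph β) (G : SimpleGraph α) : Prop :=
  ∃ B : β → Set α, IsMinorModel H G B

/-- `G` contains `k` models of `H` whose vertex sets are pairwise disjoint
(equivalently, the disjoint union of `k` copies of `H` is a minor of `G`). -/
def HasDisjointModels {β α : Type*} (H : SimpleGraph β) (G : SimpleGraph α) (k : ℕ) : Prop :=
  ∃ M : Fin k → β → Set α, (∀ i, IsMinorModel H G (M i)) ∧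
    Pairwise fun i j => Disjoint (⋃ u, M i u) (⋃ u, M j u)

/-- `pack_H(G)`: the maximum number of pairwise disjoint models of `H` in `G`. -/
noncomputable def packNumber {β α : Type*} (H : SimpleGraph β) (G : SimpleGraph α) : ℕ :=
  sSup {k | HasDisjointModels H G k}

/-- `S` meets every model of `H` in `G`. -/
def IsHittingSet {β α : Type*} (H : SimpleGraph β) (G : SimpleGraph α) (S : Set α) : Prop :=
  ∀ B : β → Set α, IsMinorModel H G B → ∃ a ∈ S, ∃ u, a ∈ B u

/-- `cover_H(G)`: the minimum size of a set of vertices meeting every model of `H` in `G`. -/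
noncomputable def coverNumber {β α : Type*} (H : SimpleGraph β) (G : SimpleGraph α) : ℕ :=
  sInf {n | ∃ S : Set α, IsHittingSet H G S ∧ S.ncard = n}

/-- A tree/path decomposition of `G` with underlying graph `T` and bags `X`. -/
def IsTreeDecomp {α ι : Type*} (G : SimpleGraph α) (T : SimpleGraph ι) (X : ι → Set α) : Prop :=
  (∀ v, ∃ t, v ∈ X t) ∧
  (∀ u v, G.Adj u v → ∃ t, u ∈ X t ∧ v ∈ X t) ∧
  (∀ v, (T.induce {t | v ∈ X t}).Connected)

/-- The treewidth of `G`: the minimum width of a tree decomposition of `G`. -/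
noncomputable def treewidth {α : Type*} (G : SimpleGraph α) : ℕ :=
  sInf {w | ∃ (ι : Type) (T : SimpleGraph ι) (X : ι → Set α),
    T.IsTree ∧ IsTreeDecomp G T X ∧ ∀ t, (X t).ncard ≤ w + 1}

/-- The pathwidth of `G`: the minimum width of a tree decomposition whose
underlying tree is a path. -/
noncomputable def pathwidth {α : Type*} (G : SimpleGraph α) : ℕ :=
  sInf {w | ∃ (n : ℕ) (X : Fin (n+1) → Set α),
    IsTreeDecomp G (pathGraph (n+1)) X ∧ ∀ t, (X t).ncard ≤ w + 1}

/-- The degeneracy of `G`: the maximum over all (nonempty) subgraphs of `G`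
of the minimum degree. -/
noncomputable def degeneracy {α : Type*} (G : SimpleGraph α) : ℕ :=
  sSup {d | ∃ G' : G.Subgraph, G'.verts.Nonempty ∧ ∀ v ∈ G'.verts, d ≤ (G'.neighborSet v).ncard}

/-- The contraction degeneracy of `G`: the maximum over all (nonempty) minors of `G`
of the minimum degree. -/
noncomputable def contractionDegeneracy {α : Type*} (G : SimpleGraph α) : ℕ :=
  sSup {d | ∃ (n : ℕ) (H : SimpleGraph (Fin n)), 0 < n ∧ IsMinor H G ∧
    ∀ v, d ≤ (H.neighborSet v).ncard}


/-- `X` and `Y` are externally `q`-connected within the vertex set `W` of `G`: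
for all disjoint `X' ⊆ X`, `Y' ⊆ Y` with `|X'| = |Y'| ≤ q` there are `|X'|`
pairwise disjoint `X'`–`Y'` paths (inside `W`) having no internal vertices and
no edges in `G[X ∪ Y]`. -/
def ExternallyConnectedIn {α : Type*} (G : SimpleGraph α) (W X Y : Set α) (q : ℕ) : Prop :=
  ∀ X' Y' : Finset α, ↑X' ⊆ X → ↑Y' ⊆ Y → Disjoint (X' : Set α) (Y' : Set α) →
    X'.card = Y'.card → X'.card ≤ q →
    ∃ p : (x : X') → Σ y : Y', G.Walk x.1 y.1,
      (∀ x, (p x).2.IsPath) ∧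
      (∀ x, ∀ v ∈ (p x).2.support, v ∈ W) ∧
      (Pairwise fun x₁ x₂ => ∀ v, v ∈ (p x₁).2.support → v ∉ (p x₂).2.support) ∧
      (∀ x, ∀ v ∈ (p x).2.support.tail.dropLast, v ∉ X ∪ Y) ∧
      (∀ x, ∀ u v : α, s(u, v) ∈ (p x).2.edges → ¬(u ∈ X ∪ Y ∧ v ∈ X ∪ Y))

/-- `(A, B)` is a `q`-mesh of order `s` in `G`. -/
def IsMesh {α : Type*} (G : SimpleGraph α) (A B : Set α) (q s : ℕ) : Prop :=
  A ∪ B = Set.univ ∧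
  ∃ T : G.Subgraph, T.verts ⊆ A ∧ T.coe.IsTree ∧
    (∀ v ∈ T.verts, (T.neighborSet v).ncard ≤ 3) ∧
    A ∩ B ⊆ T.verts ∧
    (∀ v ∈ A ∩ B, (T.neighborSet v).ncard ≤ 2) ∧
    (∃ v ∈ A ∩ B, (T.neighborSet v).ncard = 1) ∧
    (A ∩ B).ncard = s ∧
    ExternallyConnectedIn G B (A ∩ B) (A ∩ B) q

/-- The graph `Ξ_r`, with vertices `x_i = (0,i)`, `y_i = (1,i)`, `z_i = (2,i)`. -/
def Xi (r : ℕ) : SimpleGraph (Fin 3 × Fin r) :=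
  SimpleGraph.fromRel (fun a b =>
    (a.1 = 0 ∧ b.1 = 0 ∧ (b.2 : ℕ) = (a.2 : ℕ) + 1) ∨
    (a.1 = 2 ∧ b.1 = 2 ∧ (b.2 : ℕ) = (a.2 : ℕ) + 1) ∨
    (a.1 = 1 ∧ a.2 = b.2 ∧ (b.1 = 0 ∨ b.1 = 2)))

/-- The underlying simple bipartite graph of the bipartite multigraph with
parts `α`, `β` and multiplicity function `m`. -/
def bipMulti {α β : Type*} (m : α → β → ℕ) : SimpleGraph (α ⊕ β) :=
  SimpleGraph.fromRel (fun x y => match x, y with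
    | Sum.inl v, Sum.inr u => 1 ≤ m v u
    | _, _ => False)


open scoped Classical in
lemma exists_dominating_finset {V : Type*} (G : SimpleGraph V) {S W : Finset V}
    {l : ℕ} (hl : 1 ≤ l) (hS : S.Nonempty) (hW : 4 * S.card ≤ 5 * W.card)
    (hdeg : ∀ v ∈ S, W.card ≤ 3 * (W.filter (G.Adj v)).card)
    {ι : Type*} (J : Finset ι) (A : ι → Finset V)
    (hA : ∀ j ∈ J, 4 ^ l * (A j).card ≤ 2 * S.card) (hJ : J.card ≤ 2 ^ (l ^ 2)) :
    ∃ T ⊆ W, T.Nonempty ∧ T.card ≤ 4 * l ∧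
      4 ^ l * (S.filter fun v => ∀ x ∈ T, ¬ G.Adj v x).card ≤ 2 * S.card ∧
      ∀ j ∈ J, ∃ x ∈ T, x ∉ A j := by
  have hSpos : 0 < S.card := hS.card_pos
  have hWpos : 0 < W.card := by omega
  set Ω : Finset (Fin (4 * l) → V) := Fintype.piFinset fun _ => W with hΩ
  have hΩcard : Ω.card = W.card ^ (4 * l) := by simp [hΩ]
  set bad₀ := Ω.filter fun f =>
    2 * S.card < 4 ^ l * (S.filter fun v => ∀ i, ¬ G.Adj v (f i)).card
  set bad : ι → Finset (Fin (4 * l) → V) := fun j => Ω.filter fun f => ∀ i, f i ∈ A j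
  have hbad₀ : 2 * bad₀.card < Ω.card := by
    have hswap : ∑ f ∈ Ω, (S.filter fun v => ∀ i, ¬ G.Adj v (f i)).card
        = ∑ v ∈ S, (W.filter fun w => ¬ G.Adj v w).card ^ (4 * l) := by
      simp_rw [Finset.card_filter]
      rw [Finset.sum_comm]
      refine Finset.sum_congr rfl fun v _ => ?_
      rw [← Finset.card_filter, ← Finset.card_filter]
      have : Ω.filter (fun f => ∀ i, ¬ G.Adj v (f i))
          = Fintype.piFinset fun _ => W.filter fun w => ¬ G.Adj v w := by
        ext f; simp [hΩ, Fintype.mem_piFinset, forall_and]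
      rw [this]; simp
    have hpow : ∀ v ∈ S, 81 ^ l * (W.filter fun w => ¬ G.Adj v w).card ^ (4 * l)
        ≤ 16 ^ l * Ω.card := by
      intro v hv
      have h1 := Finset.card_filter_add_card_filter_not (s := W) (G.Adj v)
      have h2 := hdeg v hv
      have h3 : 3 * (W.filter fun w => ¬ G.Adj v w).card ≤ 2 * W.card := by omega
      have h4 := Nat.pow_le_pow_left h3 (4 * l)
      rw [mul_pow, mul_pow, pow_mul 3, pow_mul 2] at h4
      rw [hΩcard]; exact h4
    have hlow : bad₀.card * (2 * S.card)
        ≤ 4 ^ l * ∑ f ∈ Ω, (S.filter fun v => ∀ i, ¬ G.Adj v (f i)).card := by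
      rw [Finset.mul_sum, ← smul_eq_mul, ← Finset.sum_const]
      refine (Finset.sum_le_sum fun f hf => (Finset.mem_filter.1 hf).2.le).trans ?_
      exact Finset.sum_le_sum_of_subset (Finset.filter_subset _ _)
    have hup : 81 ^ l * ∑ f ∈ Ω, (S.filter fun v => ∀ i, ¬ G.Adj v (f i)).card
        ≤ S.card * (16 ^ l * Ω.card) := by
      rw [hswap, Finset.mul_sum]
      exact (Finset.sum_le_card_nsmul _ _ _ hpow).trans_eq (smul_eq_mul _ _)
    have h64 : 64 ^ l < 81 ^ l := Nat.pow_lt_pow_left (by norm_num) (by omega)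
    have hΩpos : 0 < Ω.card := by rw [hΩcard]; positivity
    have h5 : 81 ^ l * (2 * bad₀.card) * S.card ≤ 64 ^ l * Ω.card * S.card := by
      have : (64 : ℕ) ^ l = 4 ^ l * 16 ^ l := by rw [← mul_pow]; norm_num
      rw [this]
      calc 81 ^ l * (2 * bad₀.card) * S.card = 81 ^ l * (bad₀.card * (2 * S.card)) := by ring
        _ ≤ 81 ^ l * (4 ^ l * _) := Nat.mul_le_mul_left _ hlow
        _ = 4 ^ l * (81 ^ l * _) := by ring
        _ ≤ 4 ^ l * (S.card * (16 ^ l * Ω.card)) := Nat.mul_le_mul_left _ hup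
        _ = _ := by ring
    have h6 := Nat.le_of_mul_le_mul_right h5 hSpos
    have h7 : 64 ^ l * Ω.card < 81 ^ l * Ω.card := Nat.mul_lt_mul_of_pos_right h64 hΩpos
    exact Nat.lt_of_mul_lt_mul_left (h6.trans_lt h7)
  have hbad : ∀ j ∈ J, 2 ^ (l ^ 2) * (2 * (bad j).card) ≤ Ω.card := by
    intro j hj
    have h1 : (bad j).card ≤ (A j).card ^ (4 * l) := by
      have : bad j ⊆ Fintype.piFinset fun _ => A j := fun f hf =>
        Fintype.mem_piFinset.2 (Finset.mem_filter.1 hf).2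
      simpa using Finset.card_le_card this
    have h2 : 2 * (4 ^ l * (A j).card) ≤ 5 * W.card := by have := hA j hj; omega
    have h3 := Nat.pow_le_pow_left h2 (4 * l)
    have h4 : (2 * (4 ^ l * (A j).card)) ^ (4 * l)
        = 16 ^ l * (2 ^ (8 * l ^ 2) * (A j).card ^ (4 * l)) := by
      have h16 : (16 : ℕ) ^ l = 2 ^ (4 * l) := by rw [pow_mul]; norm_num
      have h8 : ((4 : ℕ) ^ l) ^ (4 * l) = 2 ^ (8 * l ^ 2) := by
        rw [show (4 : ℕ) = 2 ^ 2 by norm_num, ← pow_mul, ← pow_mul]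
        ring_nf
      rw [mul_pow, mul_pow, h16, h8]
    have h5 : (5 * W.card) ^ (4 * l) = 625 ^ l * Ω.card := by
      rw [mul_pow, pow_mul 5, hΩcard]; norm_num
    rw [h4, h5] at h3
    have h6 : 2 * 625 ^ l * 2 ^ (l ^ 2) ≤ 16 ^ l * 2 ^ (8 * l ^ 2) := by
      have e : (2 : ℕ) ^ (8 * l ^ 2) = 2 ^ (7 * l ^ 2) * 2 ^ (l ^ 2) := by
        rw [← pow_add]; ring_nf
      rw [e, ← mul_assoc]
      refine Nat.mul_le_mul_right _ ?_
      have : (2 : ℕ) ^ (7 * l) ≤ 2 ^ (7 * l ^ 2) :=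
        Nat.pow_le_pow_right (by norm_num) (by nlinarith)
      calc 2 * 625 ^ l ≤ 2 ^ l * 625 ^ l :=
            Nat.mul_le_mul_right _ (Nat.le_self_pow (by omega) 2)
        _ = 1250 ^ l := by rw [← mul_pow]; norm_num
        _ ≤ 2048 ^ l := Nat.pow_le_pow_left (by norm_num) _
        _ = 16 ^ l * 2 ^ (7 * l) := by rw [pow_mul, ← mul_pow]; norm_num
        _ ≤ _ := Nat.mul_le_mul_left _ this
    have h7 : 625 ^ l * (2 ^ (l ^ 2) * (2 * (bad j).card)) ≤ 625 ^ l * Ω.card := by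
      calc _ = (2 * 625 ^ l * 2 ^ (l ^ 2)) * (bad j).card := by ring
        _ ≤ (16 ^ l * 2 ^ (8 * l ^ 2)) * (A j).card ^ (4 * l) := Nat.mul_le_mul h6 h1
        _ = 16 ^ l * (2 ^ (8 * l ^ 2) * (A j).card ^ (4 * l)) := by ring
        _ ≤ _ := h3
    exact Nat.le_of_mul_le_mul_left h7 (by positivity)
  have hunion : 2 * (J.biUnion bad).card ≤ Ω.card := by
    have h1 : (J.biUnion bad).card ≤ ∑ j ∈ J, (bad j).card := Finset.card_biUnion_le
    have h2 : 2 ^ (l ^ 2) * ∑ j ∈ J, 2 * (bad j).card ≤ 2 ^ (l ^ 2) * Ω.card := by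
      rw [Finset.mul_sum]
      refine (Finset.sum_le_sum hbad).trans ?_
      rw [Finset.sum_const, smul_eq_mul]
      exact Nat.mul_le_mul_right _ hJ
    have h3 := Nat.le_of_mul_le_mul_left h2 (by positivity)
    rw [← Finset.mul_sum] at h3
    omega
  obtain ⟨f, hf, hf'⟩ : ∃ f ∈ Ω, f ∉ bad₀ ∪ J.biUnion bad := by
    by_contra! hcon
    have h1 := Finset.card_le_card (show Ω ⊆ bad₀ ∪ J.biUnion bad from hcon)
    have h2 := Finset.card_union_le bad₀ (J.biUnion bad)
    omega
  simp only [Finset.mem_union, Finset.mem_biUnion, not_or, not_exists, not_and] at hf'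
  obtain ⟨hf0, hfj⟩ := hf'
  have hfW : ∀ i, f i ∈ W := Fintype.mem_piFinset.1 hf
  refine ⟨Finset.univ.image f, ?_, ?_, ?_, ?_, ?_⟩
  · simpa [Finset.subset_iff] using hfW
  · exact ⟨f ⟨0, by omega⟩, by simp⟩
  · simpa using Finset.card_image_le (s := Finset.univ) (f := f)
  · simpa [bad₀, hf] using hf0
  · intro j hj
    simpa [bad, hf] using hfj j hj

lemma card_filter_le_card_filter_sdiff_add {V : Type*} [DecidableEq V]
    (S U : Finset V) (p : V → Prop) [DecidablePred p] :
    (S.filter p).card ≤ ((S \ U).filter p).card + U.card := by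
  refine (Finset.card_le_card fun x hx => ?_).trans (Finset.card_union_le _ _)
  simp only [Finset.mem_filter, Finset.mem_union, Finset.mem_sdiff] at hx ⊢
  tauto

lemma exists_connected_finset_superset {V : Type*} [DecidableEq V]
    (G : SimpleGraph V) {W T : Finset V} (hT : T.Nonempty) (hTW : T ⊆ W) {c : ℕ}
    (hconn : ∀ x ∈ W, ∀ y ∈ W, ∃ P ⊆ W, P.card ≤ c ∧ x ∈ P ∧ y ∈ P ∧
      (G.induce (P : Set V)).Connected) :
    ∃ B ⊆ W, T ⊆ B ∧ B.card ≤ c * T.card ∧ (G.induce (B : Set V)).Connected := by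
  obtain ⟨x, hx⟩ := hT
  have h : ∀ y : V, ∃ P : Finset V, y ∈ T → P ⊆ W ∧ P.card ≤ c ∧ x ∈ P ∧ y ∈ P ∧
      (G.induce (P : Set V)).Connected := fun y => by
    by_cases hy : y ∈ T
    · obtain ⟨P, hP⟩ := hconn x (hTW hx) y (hTW hy)
      exact ⟨P, fun _ => hP⟩
    · exact ⟨∅, fun h => absurd h hy⟩
  choose P hP using h
  refine ⟨T.biUnion P, Finset.biUnion_subset.2 fun y hy => (hP y hy).1,
    fun y hy => Finset.mem_biUnion.2 ⟨y, hy, (hP y hy).2.2.2.1⟩, ?_, ?_⟩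
  · rw [mul_comm]
    exact Finset.card_biUnion_le_card_mul _ _ _ fun y hy => (hP y hy).2.1
  · refine induce_connected_of_patches x (by simpa using ⟨x, hx, (hP x hx).2.2.1⟩) ?_
    intro v hv
    obtain ⟨y, hy, hvy⟩ := Finset.mem_biUnion.1 (Finset.mem_coe.1 hv)
    refine ⟨P y, ?_, (hP y hy).2.2.1, hvy, (hP y hy).2.2.2.2.preconnected _ _⟩
    exact_mod_cast Finset.subset_biUnion_of_mem P hy

open scoped Classical in
lemma exists_branch_sets {V : Type*} (G : SimpleGraph V) {S : Finset V} {l t : ℕ}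
    (hl : 1 ≤ l) (ht : t ≤ 2 ^ (l ^ 2)) (hS : S.Nonempty) (hsize : 120 * (t * l) ≤ S.card)
    (hdeg : ∀ v ∈ S, S.card + 72 * (t * l) ≤ 3 * (S.filter (G.Adj v)).card)
    (hconn : ∀ U : Finset V, U.card ≤ 24 * (t * l) → ∀ x ∈ S \ U, ∀ y ∈ S \ U,
      ∃ P ⊆ S \ U, P.card ≤ 6 ∧ x ∈ P ∧ y ∈ P ∧ (G.induce (P : Set V)).Connected)
    (j : ℕ) (hj : j ≤ t) :
    ∃ B : ℕ → Finset V,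
      (∀ i < j, B i ⊆ S ∧ (B i).card ≤ 24 * l ∧ (G.induce (B i : Set V)).Connected ∧
        4 ^ l * (S.filter fun v => ∀ x ∈ B i, ¬ G.Adj v x).card ≤ 2 * S.card) ∧
      ∀ i < j, ∀ i' < i, Disjoint (B i') (B i) ∧ ∃ a ∈ B i', ∃ b ∈ B i, G.Adj a b := by
  induction j with
  | zero => exact ⟨fun _ => ∅, by simp, by simp⟩
  | succ j ih =>
    obtain ⟨B, hB, hBB⟩ := ih (by omega)
    set U := (Finset.range j).biUnion B with hU
    have hUcard : U.card ≤ 24 * (t * l) := by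
      have h1 : U.card ≤ (Finset.range j).card * (24 * l) :=
        Finset.card_biUnion_le_card_mul _ _ _ fun i hi => (hB i (Finset.mem_range.1 hi)).2.1
      rw [Finset.card_range] at h1
      nlinarith
    have hW := Finset.le_card_sdiff U S
    have hWS : (S \ U).card ≤ S.card := Finset.card_le_card Finset.sdiff_subset
    have hdegW : ∀ v ∈ S, (S \ U).card ≤ 3 * ((S \ U).filter (G.Adj v)).card := by
      intro v hv
      have h1 := hdeg v hv
      have h2 := card_filter_le_card_filter_sdiff_add S U (G.Adj v)
      omega
    obtain ⟨T, hTW, hTne, hTcard, hTdom, hTA⟩ := exists_dominating_finset G hl hS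
      (W := S \ U) (by omega) hdegW (Finset.range j)
      (fun i => S.filter fun v => ∀ x ∈ B i, ¬ G.Adj v x)
      (fun i hi => (hB i (Finset.mem_range.1 hi)).2.2.2) (by rw [Finset.card_range]; omega)
    obtain ⟨P, hPW, hTP, hPcard, hPconn⟩ :=
      exists_connected_finset_superset G hTne hTW (hconn U hUcard)
    have hPS : P ⊆ S := hPW.trans Finset.sdiff_subset
    have hne : ∀ i < j, Function.update B j P i = B i := fun i hi =>
      Function.update_of_ne hi.ne _ _
    refine ⟨Function.update B j P, fun i hi => ?_, fun i hi i' hi' => ?_⟩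
    · rcases Nat.lt_succ_iff_lt_or_eq.1 hi with hi | rfl
      · rw [hne i hi]; exact hB i hi
      · rw [Function.update_self]
        refine ⟨hPS, by omega, hPconn, le_trans (Nat.mul_le_mul_left _ ?_) hTdom⟩
        refine Finset.card_le_card (Finset.monotone_filter_right _ ?_)
        exact fun v _ hv x hx => hv x (hTP hx)
    · rcases Nat.lt_succ_iff_lt_or_eq.1 hi with hi | rfl
      · rw [hne i hi, hne i' (hi'.trans hi)]; exact hBB i hi i' hi'
      · rw [Function.update_self, hne i' hi']
        refine ⟨?_, ?_⟩
        · refine Finset.disjoint_left.2 fun x hx hxP => ?_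
          exact (Finset.mem_sdiff.1 (hPW hxP)).2
            (Finset.mem_biUnion.2 ⟨i', Finset.mem_range.2 hi', hx⟩)
        · obtain ⟨x, hxT, hx⟩ := hTA i' (Finset.mem_range.2 hi')
          have hxS := hPS (hTP hxT)
          simp only [Finset.mem_filter, hxS, true_and, not_forall, not_not] at hx
          obtain ⟨a, ha, hxa⟩ := hx
          exact ⟨a, ha, x, hTP hxT, hxa.symm⟩

lemma exists_connected_finset_card_le_six {V : Type*} [DecidableEq V] (G : SimpleGraph V)
    [DecidableRel G.Adj] {W : Finset V} {δ : ℕ} (hdeg : ∀ v ∈ W, δ ≤ (W.filter (G.Adj v)).card)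
    (hδ : W.card < 3 * δ)
    (hsep : ∀ X ⊆ W, X.Nonempty → X ≠ W → ∃ x ∈ X, ∃ y ∈ W \ X, G.Adj x y)
    {x y : V} (hx : x ∈ W) (hy : y ∈ W) :
    ∃ P ⊆ W, P.card ≤ 6 ∧ x ∈ P ∧ y ∈ P ∧ (G.induce (P : Set V)).Connected := by
  set ball : ℕ → Finset V := fun n =>
    Nat.rec {x} (fun _ X => X ∪ W.filter fun z => ∃ w ∈ X, G.Adj w z) n
  have hsucc : ∀ n, ball (n + 1) = ball n ∪ W.filter fun z => ∃ w ∈ ball n, G.Adj w z :=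
    fun n => rfl
  have hzero : ball 0 = {x} := rfl
  have hmono : Monotone ball := monotone_nat_of_le_succ fun n => by
    rw [hsucc]; exact Finset.subset_union_left
  have hballW : ∀ n, ball n ⊆ W := by
    intro n
    induction n with
    | zero => simpa [hzero] using hx
    | succ n ih => rw [hsucc]; exact Finset.union_subset ih (Finset.filter_subset _ _)
  have hxball : ∀ n, x ∈ ball n := fun n => hmono (Nat.zero_le n) (by simp [hzero])
  have hstep : ∀ n, ∀ w ∈ ball n, W.filter (G.Adj w) ⊆ ball (n + 1) := by
    intro n w hw z hz
    rw [Finset.mem_filter] at hz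
    rw [hsucc]
    exact Finset.mem_union_right _ (Finset.mem_filter.2 ⟨hz.1, w, hw, hz.2⟩)
  have hpath : ∀ n, ∀ z ∈ ball n, ∃ P ⊆ W, P.card ≤ n + 1 ∧ x ∈ P ∧ z ∈ P ∧
      (G.induce (P : Set V)).Connected := by
    intro n
    induction n with
    | zero =>
      intro z hz
      obtain rfl : z = x := by simpa [hzero] using hz
      refine ⟨{z}, by simpa using hx, by simp, by simp, by simp, ?_⟩
      rw [Finset.coe_singleton]
      exact Connected.of_subsingleton
    | succ n ih =>
      intro z hz
      rw [hsucc, Finset.mem_union, Finset.mem_filter] at hz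
      rcases hz with hz | ⟨hzW, w, hw, hwz⟩
      · obtain ⟨P, h1, h2, h3⟩ := ih z hz
        exact ⟨P, h1, by omega, h3⟩
      · obtain ⟨P, h1, h2, h3, h4, h5⟩ := ih w hw
        refine ⟨insert z P, Finset.insert_subset hzW h1,
          (Finset.card_insert_le _ _).trans (by omega), Finset.mem_insert_of_mem h3,
          Finset.mem_insert_self _ _, ?_⟩
        have := induce_union_connected h5.preconnected
          (induce_pair_connected_of_adj hwz).preconnected ⟨w, by simpa using h4, by simp⟩
        have hset : ((insert z P : Finset V) : Set V) = ↑P ∪ {w, z} := by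
          ext a
          simp only [Finset.coe_insert, Set.mem_insert_iff, Finset.mem_coe, Set.mem_union,
            Set.mem_singleton_iff]
          constructor
          · tauto
          · rintro (h | rfl | h) <;> tauto
        rwa [hset]
  suffices y ∈ ball 5 from hpath 5 y this
  by_contra hy5
  obtain ⟨a, ha, z, hz, haz⟩ := hsep (ball 2) (hballW 2) ⟨x, hxball 2⟩
    (fun h => hy5 (hmono (show 2 ≤ 5 by norm_num) (h ▸ hy)))
  rw [Finset.mem_sdiff] at hz
  have hz3 : z ∈ ball 3 := hstep 2 a ha (Finset.mem_filter.2 ⟨hz.1, haz⟩)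
  have hd1 : Disjoint (W.filter (G.Adj x)) (W.filter (G.Adj z)) := by
    refine Finset.disjoint_left.2 fun b hb hb' => hz.2 ?_
    exact hstep 1 b (hstep 0 x (hxball 0) hb)
      (Finset.mem_filter.2 ⟨hz.1, (Finset.mem_filter.1 hb').2.symm⟩)
  have hd2 : Disjoint (W.filter (G.Adj x) ∪ W.filter (G.Adj z)) (W.filter (G.Adj y)) := by
    refine Finset.disjoint_left.2 fun b hb hb' => hy5 ?_
    have hb4 : b ∈ ball 4 := by
      rcases Finset.mem_union.1 hb with hb | hb
      · exact hmono (show 1 ≤ 4 by norm_num) (hstep 0 x (hxball 0) hb)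
      · exact hstep 3 z hz3 hb
    exact hstep 4 b hb4 (Finset.mem_filter.2 ⟨hy, (Finset.mem_filter.1 hb').2.symm⟩)
  have h1 := Finset.card_union_of_disjoint hd1
  have h2 := Finset.card_union_of_disjoint hd2
  have h3 : (W.filter (G.Adj x) ∪ W.filter (G.Adj z) ∪ W.filter (G.Adj y)).card ≤ W.card :=
    Finset.card_le_card (by
      simp only [Finset.union_subset_iff]
      exact ⟨⟨Finset.filter_subset _ _, Finset.filter_subset _ _⟩, Finset.filter_subset _ _⟩)
  have h4 := hdeg x hx
  have h5 := hdeg y hy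
  have h6 := hdeg z hz.1
  omega

/-- `G` has a model of `K_t` all of whose branch sets lie in `S`. -/
def HasCompleteMinorIn {V : Type*} (G : SimpleGraph V) (t : ℕ) (S : Finset V) : Prop :=
  ∃ B : Fin t → Set V, (∀ i, B i ⊆ S) ∧ IsMinorModel (completeGraph (Fin t)) G B

lemma HasCompleteMinorIn.mono {V : Type*} {G G' : SimpleGraph V} {t : ℕ} {S S' : Finset V}
    (h : HasCompleteMinorIn G t S) (hG : G ≤ G') (hS : S ⊆ S') : HasCompleteMinorIn G' t S' := by
  obtain ⟨B, hBS, h1, h2, h3⟩ := h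
  refine ⟨B, fun i => (hBS i).trans (by exact_mod_cast hS), fun i => (h1 i).mono ?_, h2, ?_⟩
  · exact fun a b hab => hG hab
  · intro u v huv
    obtain ⟨a, ha, b, hb, hab⟩ := h3 u v huv
    exact ⟨a, ha, b, hb, hG hab⟩

open scoped Classical in
lemma hasCompleteMinorIn_of_connectors {V : Type*} (G : SimpleGraph V) {S : Finset V} {l t : ℕ}
    (hl : 1 ≤ l) (ht : t ≤ 2 ^ (l ^ 2)) (hS : S.Nonempty) (hsize : 120 * (t * l) ≤ S.card)
    (hdeg : ∀ v ∈ S, S.card + 72 * (t * l) ≤ 3 * (S.filter (G.Adj v)).card)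
    (hconn : ∀ U : Finset V, U.card ≤ 24 * (t * l) → ∀ x ∈ S \ U, ∀ y ∈ S \ U,
      ∃ P ⊆ S \ U, P.card ≤ 6 ∧ x ∈ P ∧ y ∈ P ∧ (G.induce (P : Set V)).Connected) :
    HasCompleteMinorIn G t S := by
  obtain ⟨B, hB, hBB⟩ := exists_branch_sets G hl ht hS hsize hdeg hconn t le_rfl
  refine ⟨fun i => B i, fun i => by exact_mod_cast (hB i i.2).1,
    fun i => (hB i i.2).2.2.1, ?_, ?_⟩
  · intro i j hij
    rw [Finset.disjoint_coe]
    rcases lt_or_gt_of_ne hij with h | h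
    · exact (hBB j j.2 i h).1
    · exact (hBB i i.2 j h).1.symm
  · intro i j hij
    rcases lt_or_gt_of_ne hij.ne with h | h
    · exact (hBB j j.2 i h).2
    · obtain ⟨a, ha, b, hb, hab⟩ := (hBB i i.2 j h).2
      exact ⟨b, hb, a, ha, hab.symm⟩

open scoped Classical in
lemma hasCompleteMinorIn_of_card_le {V : Type*} (G : SimpleGraph V) {X : Finset V} {l t : ℕ}
    (hl : 1 ≤ l) (ht₀ : 1 ≤ t) (ht : t ≤ 2 ^ (l ^ 2)) (hX : X.Nonempty)
    (hXcard : X.card ≤ 162 * (t * l))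
    (hdeg : ∀ v ∈ X, 138 * (t * l) ≤ (X.filter (G.Adj v)).card) :
    HasCompleteMinorIn G t X := by
  have hk : 1 ≤ t * l := Nat.mul_pos ht₀ hl
  refine hasCompleteMinorIn_of_connectors G hl ht hX ?_ ?_ ?_
  · obtain ⟨v, hv⟩ := hX
    have h1 := hdeg v hv
    have h2 := Finset.card_filter_le X (G.Adj v)
    omega
  · intro v hv
    have := hdeg v hv
    omega
  · intro U hU x hx y hy
    have hX' : (X \ U).card ≤ X.card := Finset.card_le_card Finset.sdiff_subset
    have hdeg' : ∀ v ∈ X \ U, 114 * (t * l) ≤ ((X \ U).filter (G.Adj v)).card := fun v hv => by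
      have h1 := hdeg v (Finset.mem_sdiff.1 hv).1
      have h2 := card_filter_le_card_filter_sdiff_add X U (G.Adj v)
      omega
    refine exists_connected_finset_card_le_six G hdeg' (by omega) ?_ hx hy
    intro Y hY ⟨a, ha⟩ hYne
    obtain ⟨b, hbW, hbY⟩ := Finset.exists_of_ssubset (hY.ssubset_of_ne hYne)
    have h1 := hdeg' a (hY ha)
    have h2 := hdeg' b hbW
    obtain ⟨c, hc⟩ : ((X \ U).filter (G.Adj a) ∩ (X \ U).filter (G.Adj b)).Nonempty := by
      rw [← Finset.card_pos]
      have h3 := Finset.card_union_add_card_inter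
        ((X \ U).filter (G.Adj a)) ((X \ U).filter (G.Adj b))
      have h4 := Finset.card_le_card (Finset.union_subset
        (Finset.filter_subset (G.Adj a) (X \ U)) (Finset.filter_subset (G.Adj b) (X \ U)))
      omega
    simp only [Finset.mem_inter, Finset.mem_filter] at hc
    by_cases hcY : c ∈ Y
    · exact ⟨c, hcY, b, Finset.mem_sdiff.2 ⟨hbW, hbY⟩, hc.2.2.symm⟩
    · exact ⟨a, ha, c, Finset.mem_sdiff.2 ⟨hc.1.1, hcY⟩, hc.1.2⟩

open scoped Classical in
lemma hasCompleteMinorIn_of_dense {V : Type*} (G : SimpleGraph V) {S : Finset V} {l t : ℕ}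
    (hl : 1 ≤ l) (ht₀ : 1 ≤ t) (ht : t ≤ 2 ^ (l ^ 2)) (hS : S.Nonempty)
    (hScard : S.card ≤ 324 * (t * l))
    (hdeg : ∀ v ∈ S, 162 * (t * l) ≤ (S.filter (G.Adj v)).card) :
    HasCompleteMinorIn G t S := by
  have hk : 1 ≤ t * l := Nat.mul_pos ht₀ hl
  have hdeg' : ∀ U : Finset V, U.card ≤ 24 * (t * l) → ∀ v ∈ S,
      138 * (t * l) ≤ ((S \ U).filter (G.Adj v)).card := fun U hU v hv => by
    have h1 := hdeg v hv
    have h2 := card_filter_le_card_filter_sdiff_add S U (G.Adj v)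
    omega
  by_cases hsep : ∀ U : Finset V, U.card ≤ 24 * (t * l) → ∀ X ⊆ S \ U, X.Nonempty → X ≠ S \ U →
      ∃ x ∈ X, ∃ y ∈ (S \ U) \ X, G.Adj x y
  · refine hasCompleteMinorIn_of_connectors G hl ht hS ?_ ?_ ?_
    · obtain ⟨v, hv⟩ := hS
      have h1 := hdeg v hv
      have h2 := Finset.card_filter_le S (G.Adj v)
      omega
    · intro v hv
      have := hdeg v hv
      omega
    · intro U hU x hx y hy
      have hS' : (S \ U).card ≤ S.card := Finset.card_le_card Finset.sdiff_subset
      exact exists_connected_finset_card_le_six G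
        (fun v hv => hdeg' U hU v (Finset.mem_sdiff.1 hv).1) (by omega) (hsep U hU) hx hy
  · push Not at hsep
    obtain ⟨U, hU, X, hXW, hXne, hXW', hXsep⟩ := hsep
    have key : ∀ Y ⊆ S \ U, Y.Nonempty → (∀ x ∈ Y, ∀ y ∈ (S \ U) \ Y, ¬ G.Adj x y) →
        2 * Y.card ≤ S.card → HasCompleteMinorIn G t S := by
      intro Y hY hYne hYsep hYcard
      have hYS := hY.trans Finset.sdiff_subset
      refine (hasCompleteMinorIn_of_card_le G hl ht₀ ht hYne (by omega) ?_).mono le_rfl hYS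
      intro v hv
      refine (hdeg' U hU v (hYS hv)).trans (Finset.card_le_card fun w hw => ?_)
      rw [Finset.mem_filter] at hw ⊢
      refine ⟨?_, hw.2⟩
      by_contra hwY
      exact hYsep v hv w (Finset.mem_sdiff.2 ⟨hw.1, hwY⟩) hw.2
    have hcard := Finset.card_sdiff_add_card_eq_card hXW
    have hS' : (S \ U).card ≤ S.card := Finset.card_le_card Finset.sdiff_subset
    by_cases hX : 2 * X.card ≤ S.card
    · exact key X hXW hXne hXsep hX
    · refine key ((S \ U) \ X) Finset.sdiff_subset ?_ ?_ (by omega)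
      · exact Finset.sdiff_nonempty.2 fun h => hXW' (hXW.antisymm h)
      · intro x hx y hy hxy
        rw [Finset.sdiff_sdiff_eq_self hXW] at hy
        exact hXsep y hy x hx hxy.symm

/-- The graph obtained from `G` by contracting `u` into `v`, leaving `u` as an isolated vertex. -/
def contractInto {V : Type*} (G : SimpleGraph V) (u v : V) : SimpleGraph V where
  Adj x y := x ≠ u ∧ y ≠ u ∧ x ≠ y ∧ (G.Adj x y ∨ (x = v ∧ G.Adj u y) ∨ (y = v ∧ G.Adj u x))
  symm := ⟨fun x y h => ⟨h.2.1, h.1, h.2.2.1.symm, by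
    rcases h.2.2.2 with h | h | h
    · exact Or.inl h.symm
    · exact Or.inr (Or.inr h)
    · exact Or.inr (Or.inl h)⟩⟩
  loopless := ⟨fun x h => h.2.2.1 rfl⟩

lemma HasCompleteMinorIn.of_contractInto {V : Type*} [DecidableEq V] {G : SimpleGraph V} {t : ℕ}
    {S : Finset V} {u v : V} (huv : G.Adj u v) (hu : u ∈ S)
    (h : HasCompleteMinorIn (contractInto G u v) t (S.erase u)) : HasCompleteMinorIn G t S := by
  obtain ⟨B, hBS, hconn, hdisj, hadj⟩ := h
  have huB : ∀ i, u ∉ B i := fun i hi => by simpa using hBS i hi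
  set B' : Fin t → Set V := fun i => {x | x ∈ B i ∨ (x = u ∧ v ∈ B i)} with hB'
  have hBB' : ∀ i, B i ⊆ B' i := fun i x hx => Or.inl hx
  refine ⟨B', ?_, ?_, ?_, ?_⟩
  · rintro i x (hx | ⟨rfl, -⟩)
    · exact Finset.mem_of_mem_erase (by exact_mod_cast hBS i hx)
    · exact hu
  · intro i
    have hstep : ∀ a b : B i, ((contractInto G u v).induce (B i)).Adj a b →
        (G.induce (B' i)).Reachable ⟨a, hBB' i a.2⟩ ⟨b, hBB' i b.2⟩ := by
      rintro ⟨a, ha⟩ ⟨b, hb⟩ ⟨-, -, -, hab | ⟨hav, hub⟩ | ⟨hbv, hua⟩⟩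
      · exact Adj.reachable (G := G.induce (B' i)) hab
      · have hva : a = v := hav
        subst hva
        have hu' : u ∈ B' i := Or.inr ⟨rfl, ha⟩
        exact (Adj.reachable (G := G.induce (B' i)) (u := ⟨a, hBB' i ha⟩) (v := ⟨u, hu'⟩)
          huv.symm).trans (Adj.reachable (G := G.induce (B' i)) hub)
      · have hvb : b = v := hbv
        subst hvb
        have hu' : u ∈ B' i := Or.inr ⟨rfl, hb⟩
        exact (Adj.reachable (G := G.induce (B' i)) (u := ⟨a, hBB' i ha⟩) (v := ⟨u, hu'⟩)
          hua.symm).trans (Adj.reachable (G := G.induce (B' i)) huv)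
    have hreach : ∀ a b : B i,
        (G.induce (B' i)).Reachable ⟨a, hBB' i a.2⟩ ⟨b, hBB' i b.2⟩ := by
      intro a b
      obtain ⟨p⟩ := (hconn i).preconnected a b
      induction p with
      | nil => exact Reachable.refl _
      | cons h _ ih => exact (hstep _ _ h).trans ih
    rw [connected_iff_exists_forall_reachable]
    obtain ⟨a⟩ := (hconn i).nonempty
    refine ⟨⟨a, hBB' i a.2⟩, ?_⟩
    rintro ⟨b, hb | ⟨rfl, hv⟩⟩
    · exact hreach a ⟨b, hb⟩
    · exact (hreach a ⟨v, hv⟩).trans (Adj.reachable (G := G.induce (B' i)) huv.symm)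
  · intro i j hij
    have h := Set.disjoint_left.1 (hdisj hij)
    refine Set.disjoint_left.2 ?_
    rintro x (hx | ⟨rfl, hx⟩) (hx' | ⟨hxu, hx'⟩)
    · exact h hx hx'
    · exact huB i (hxu ▸ hx)
    · exact huB j hx'
    · exact h hx hx'
  · intro i j hij
    obtain ⟨a, ha, b, hb, -, -, -, hab | ⟨rfl, hub⟩ | ⟨rfl, hua⟩⟩ := hadj i j hij
    · exact ⟨a, hBB' i ha, b, hBB' j hb, hab⟩
    · exact ⟨u, Or.inr ⟨rfl, ha⟩, b, hBB' j hb, hub⟩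
    · exact ⟨a, hBB' i ha, u, Or.inr ⟨rfl, hb⟩, hua.symm⟩

open scoped Classical in
lemma card_edgeFinset_le_contractInto {V : Type*} [Fintype V] (G : SimpleGraph V) {u v : V}
    (huv : G.Adj u v) :
    G.edgeFinset.card ≤ (contractInto G u v).edgeFinset.card + 1 +
      ((G.neighborFinset u).filter (G.Adj v)).card := by
  set N := ((G.neighborFinset u).filter fun w => ¬ G.Adj v w).erase v with hN
  set I := N.image fun w => s(v, w) with hI
  have hIcard : I.card = N.card :=
    Finset.card_image_of_injective _ fun a b h => Sym2.congr_right.1 h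
  have hNcard : N.card + 1 + ((G.neighborFinset u).filter (G.Adj v)).card = G.degree u := by
    rw [hN, Finset.card_erase_add_one (by simp [huv]), add_comm,
      Finset.card_filter_add_card_filter_not, card_neighborFinset_eq_degree]
  have hinc : (G.edgeFinset \ G.incidenceFinset u).card + G.degree u = G.edgeFinset.card := by
    rw [← card_incidenceFinset_eq_degree]
    exact Finset.card_sdiff_add_card_eq_card (G.incidenceFinset_subset u)
  have hdisj : Disjoint (G.edgeFinset \ G.incidenceFinset u) I := by
    refine Finset.disjoint_right.2 fun e he he' => ?_
    obtain ⟨w, hw, rfl⟩ := Finset.mem_image.1 he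
    simp only [hN, Finset.mem_erase, Finset.mem_filter] at hw
    simp only [Finset.mem_sdiff, mem_edgeFinset, mem_edgeSet] at he'
    exact hw.2.2 he'.1
  have hsub : (G.edgeFinset \ G.incidenceFinset u) ∪ I ⊆ (contractInto G u v).edgeFinset := by
    intro e he
    rw [mem_edgeFinset]
    rcases Finset.mem_union.1 he with he | he
    · rw [Finset.mem_sdiff, mem_edgeFinset, mem_incidenceFinset] at he
      obtain ⟨hxy, hinc⟩ := he
      induction e with
      | h x y =>
        rw [mem_edgeSet] at hxy ⊢
        refine ⟨?_, ?_, hxy.ne, Or.inl hxy⟩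
        · rintro rfl
          exact hinc ⟨hxy, by simp⟩
        · rintro rfl
          exact hinc ⟨hxy, by simp⟩
    · obtain ⟨w, hw, rfl⟩ := Finset.mem_image.1 he
      simp only [hN, Finset.mem_erase, Finset.mem_filter, mem_neighborFinset] at hw
      exact ⟨huv.ne', hw.2.1.ne', hw.1.symm, Or.inr (Or.inl ⟨rfl, hw.2.1⟩)⟩
  have h := Finset.card_le_card hsub
  rw [Finset.card_union_of_disjoint hdisj, hIcard] at h
  omega

open scoped Classical in
lemma exists_le_card_edgeFinset_eq {V : Type*} [Fintype V] (G : SimpleGraph V) {n : ℕ}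
    (hn : n ≤ G.edgeFinset.card) : ∃ H ≤ G, H.edgeFinset.card = n := by
  obtain ⟨T, hT, hTcard⟩ := Finset.exists_subset_card_eq hn
  obtain ⟨H, hH⟩ : ∃ H : SimpleGraph V, ∀ e, e ∈ H.edgeSet ↔ e ∈ T := by
    refine ⟨fromEdgeSet (T : Set (Sym2 V)), fun e => ?_⟩
    rw [edgeSet_fromEdgeSet, Set.mem_sdiff]
    exact ⟨fun h => h.1, fun h =>
      ⟨h, G.not_isDiag_of_mem_edgeSet (mem_edgeFinset.1 (hT h))⟩⟩
  refine ⟨H, edgeSet_subset_edgeSet.1 fun e he => mem_edgeFinset.1 (hT ((hH e).1 he)), ?_⟩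
  rw [← hTcard]
  congr 1
  ext e
  exact mem_edgeFinset.trans (hH e)

open scoped Classical in
lemma hasCompleteMinorIn_of_card_edgeFinset {V : Type*} [Fintype V] {l t : ℕ}
    (hl : 1 ≤ l) (ht₀ : 1 ≤ t) (ht : t ≤ 2 ^ (l ^ 2)) (G : SimpleGraph V) (S : Finset V)
    (hS : S.Nonempty) (hsupp : ∀ a b, G.Adj a b → a ∈ S)
    (hedge : 162 * (t * l) * S.card ≤ G.edgeFinset.card) : HasCompleteMinorIn G t S := by
  have hk : 1 ≤ t * l := Nat.mul_pos ht₀ hl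
  induction hn : S.card generalizing G S with
  | zero => exact absurd hn hS.card_pos.ne'
  | succ n ih =>
    obtain ⟨H, hHG, hHcard⟩ := exists_le_card_edgeFinset_eq G hedge
    refine HasCompleteMinorIn.mono ?_ hHG subset_rfl
    have hHsupp : ∀ a b, H.Adj a b → a ∈ S := fun a b hab => hsupp a b (hHG hab)
    have hSpos := hS.card_pos
    have hHpos : 0 < H.edgeFinset.card := by rw [hHcard]; positivity
    have herase : ∀ u ∈ S, (S.erase u).card = n := fun u hu => by
      rw [Finset.card_erase_of_mem hu, hn]; rfl
    obtain ⟨x, y, hxy⟩ : ∃ x y, H.Adj x y := by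
      obtain ⟨e, he⟩ := Finset.card_pos.1 hHpos
      induction e with
      | h x y => exact ⟨x, y, by simpa using he⟩
    have herase' : ∀ u, (S.erase u).Nonempty := fun u => by
      by_cases hxu : x = u
      · exact ⟨y, Finset.mem_erase.2 ⟨fun h => hxy.ne (hxu.trans h.symm), hHsupp y x hxy.symm⟩⟩
      · exact ⟨x, Finset.mem_erase.2 ⟨hxu, hHsupp x y hxy⟩⟩
    rw [hn, mul_add, mul_one] at hHcard
    by_cases hiso : ∃ u ∈ S, ∀ w, ¬ H.Adj u w
    · obtain ⟨u, hu, hiso⟩ := hiso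
      refine (ih H (S.erase u) (herase' u) ?_ ?_ (herase u hu)).mono le_rfl
        (Finset.erase_subset _ _)
      · exact fun a b hab => Finset.mem_erase.2
          ⟨fun h => hiso b (h ▸ hab), hHsupp a b hab⟩
      · rw [herase u hu]; omega
    by_cases hcontr : ∃ u v, H.Adj u v ∧
        ((H.neighborFinset u).filter (H.Adj v)).card < 162 * (t * l)
    · obtain ⟨u, v, huv, hc⟩ := hcontr
      have hu := hHsupp u v huv
      refine (ih (contractInto H u v) (S.erase u) (herase' u) ?_ ?_ (herase u hu)).of_contractInto
        huv hu
      · rintro a b ⟨hau, -, -, hab | ⟨rfl, -⟩ | ⟨-, hab⟩⟩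
        · exact Finset.mem_erase.2 ⟨hau, hHsupp a b hab⟩
        · exact Finset.mem_erase.2 ⟨hau, hHsupp a u huv.symm⟩
        · exact Finset.mem_erase.2 ⟨hau, hHsupp a u hab.symm⟩
      · have := card_edgeFinset_le_contractInto H huv
        rw [herase u hu]
        omega
    push Not at hiso hcontr
    obtain ⟨u, hu, hdeg⟩ : ∃ u ∈ S, H.degree u ≤ 324 * (t * l) := by
      by_contra! hcon
      have h1 : ∑ v ∈ S, H.degree v = 2 * H.edgeFinset.card := by
        rw [← H.sum_degrees_eq_twice_card_edges]
        refine Finset.sum_subset (Finset.subset_univ S) fun v _ hv => ?_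
        rw [degree_eq_zero_iff_notMem_support, mem_support]
        rintro ⟨w, hw⟩
        exact hv (hHsupp v w hw)
      have h2 : ∑ v ∈ S, 324 * (t * l) < ∑ v ∈ S, H.degree v :=
        Finset.sum_lt_sum_of_nonempty hS hcon
      rw [h1, Finset.sum_const, smul_eq_mul, hHcard, hn] at h2
      nlinarith
    obtain ⟨w, huw⟩ := hiso u hu
    refine (hasCompleteMinorIn_of_dense H hl ht₀ ht (S := H.neighborFinset u)
      ⟨w, by simpa using huw⟩ hdeg ?_).mono le_rfl fun v hv =>
        hHsupp v u ((mem_neighborFinset _ _ _).1 hv).symm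
    exact fun v hv => hcontr u v ((mem_neighborFinset _ _ _).1 hv)

/-- For every `t ≥ 2`, every finite graph of average degree at
least `648 · t · √(log t)` contains `K_t` as a minor. -/
theorem kostochka_thomason (t : ℕ) (ht : 2 ≤ t) {α : Type} [Fintype α]
    (G : SimpleGraph α)
    (h : 648 * (t : ℝ) * Real.sqrt (Real.logb 2 (t : ℝ)) ≤
      (∑ v : α, ((G.neighborSet v).ncard : ℝ)) / (Fintype.card α : ℝ)) :
    IsMinor (completeGraph (Fin t)) G := by
  classical
  have ht' : (2 : ℝ) ≤ t := by exact_mod_cast ht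
  set L := Real.sqrt (Real.logb 2 (t : ℝ)) with hL
  have hlog : 1 ≤ Real.logb 2 (t : ℝ) := by
    rw [Real.le_logb_iff_rpow_le (by norm_num) (by linarith), Real.rpow_one]
    exact ht'
  have hL1 : 1 ≤ L := Real.one_le_sqrt.2 hlog
  set l := ⌈L⌉₊ with hl
  have hLl : L ≤ l := Nat.le_ceil L
  have hlL : (l : ℝ) ≤ 2 * L := by
    have := Nat.ceil_lt_add_one (show 0 ≤ L by linarith)
    linarith
  have hl1 : 1 ≤ l := by exact_mod_cast hL1.trans hLl
  have htl : t ≤ 2 ^ (l ^ 2) := by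
    have h1 : Real.logb 2 (t : ℝ) ≤ ((l ^ 2 : ℕ) : ℝ) := by
      rw [← Real.sq_sqrt (show 0 ≤ Real.logb 2 (t : ℝ) by linarith)]
      push_cast
      gcongr
    rw [Real.logb_le_iff_le_rpow (by norm_num) (by linarith), Real.rpow_natCast] at h1
    exact_mod_cast h1
  rcases isEmpty_or_nonempty α with hα | hα
  · simp only [Finset.univ_eq_empty, Finset.sum_empty, zero_div] at h
    have : 0 < 648 * (t : ℝ) * L := by positivity
    linarith
  have hsum : ∑ v : α, ((G.neighborSet v).ncard : ℝ) = 2 * (G.edgeFinset.card : ℝ) := by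
    have h1 := G.sum_degrees_eq_twice_card_edges
    have h2 : ∀ v, (G.neighborSet v).ncard = G.degree v := fun v => by
      rw [Set.ncard_eq_toFinset_card', Set.toFinset_card, card_neighborSet_eq_degree]
    simp_rw [h2]
    exact_mod_cast h1
  have hcard : 0 < (Fintype.card α : ℝ) := by exact_mod_cast Fintype.card_pos
  rw [hsum, le_div_iff₀ hcard] at h
  obtain ⟨B, -, hB⟩ := hasCompleteMinorIn_of_card_edgeFinset hl1 (by omega) htl G Finset.univ
    Finset.univ_nonempty (fun _ _ _ => Finset.mem_univ _) (by
      rw [Finset.card_univ]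
      have h1 : 324 * (t : ℝ) * l * Fintype.card α ≤ 648 * (t : ℝ) * L * Fintype.card α := by
        refine mul_le_mul_of_nonneg_right ?_ hcard.le
        nlinarith
      have h2 : ((162 * (t * l) * Fintype.card α : ℕ) : ℝ) ≤ (G.edgeFinset.card : ℝ) := by
        push_cast
        linarith
      exact_mod_cast h2)
  exact ⟨B, hB⟩
end

section
/- Let G be a graph and let p ≥ q ≥ 1 be integers. If tw(G) ≥ 5pq − 2q + 2p − 1, then there exist 2q pairwise disjoint sets X_1, …, X_{2q} ⊆ V(G), each of size p, a set A ⊆ V(G), pairwise vertex-disjoint trees T_1, …, T_{2q} (subgraphs of G with V(T_i) ⊆ A) such that T_i contains all vertices of X_i (so each X_i is connected in G by T_i), and a collection P of pq pairwise vertex-disjoint paths of G, each of length at least 2, such that every path in P has one end in some X_i with 1 ≤ i ≤ q, its other end in some X_j with q+1 ≤ j ≤ 2q, and none of its internal vertices lies in A or in any X_l (1 ≤ l ≤ 2q). -/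
open SimpleGraph

section

variable {α : Type*}

/-- Cut-based connectedness of the subgraph of `G` induced on `C`. -/
def ConnSet (G : SimpleGraph α) (C : Set α) : Prop :=
  C.Nonempty ∧ ∀ D ⊆ C, D.Nonempty → (∀ a ∈ D, ∀ b ∈ C, G.Adj a b → b ∈ D) → C ⊆ D

/-- `S` separates `A` from `B` in `G`, witnessed by a cut `D` containing `A \ S`. -/
def Separates (G : SimpleGraph α) (A B S : Set α) : Prop :=
  ∃ D : Set α, A \ S ⊆ D ∧ Disjoint D S ∧ Disjoint D B ∧
    ∀ a ∈ D, ∀ b, G.Adj a b → b ∈ D ∨ b ∈ S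

/-- There are `k` pairwise disjoint paths from `A` to `B` in `G`. -/
def Linked (G : SimpleGraph α) (A B : Set α) (k : ℕ) : Prop :=
  ∃ (u v : Fin k → α) (w : ∀ i, G.Walk (u i) (v i)), (∀ i, u i ∈ A) ∧ (∀ i, v i ∈ B) ∧
    (∀ i, (w i).IsPath) ∧ ∀ i j z, z ∈ (w i).support → z ∈ (w j).support → i = j

theorem Separates.symm {G : SimpleGraph α} {A B S : Set α} (h : Separates G A B S) :
    Separates G B A S := by
  obtain ⟨D, h1, h2, h3, h4⟩ := h
  rw [Set.disjoint_left] at h2 h3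
  refine ⟨(D ∪ S)ᶜ, ?_, ?_, ?_, ?_⟩
  · rintro b ⟨hb, hbS⟩ (hD | hS)
    exacts [h3 hD hb, hbS hS]
  · rw [Set.disjoint_left]
    exact fun a ha haS => ha (Or.inr haS)
  · rw [Set.disjoint_left]
    exact fun a ha haA => ha (Or.inl (h1 ⟨haA, fun h => ha (Or.inr h)⟩))
  · intro a ha b hab
    by_contra! hb
    have hbD : b ∈ D := by
      by_contra hD
      exact hb.1 (by rintro (h | h); exacts [hD h, hb.2 h])
    exact ha (h4 b hbD a hab.symm)

/-- If `S` separates `A` from `B`, then every separator of `A` from `S` separates `A` from `B`. -/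
theorem Separates.trans {G : SimpleGraph α} {A B S R : Set α} (h : Separates G A B S)
    (hR : Separates G A S R) : Separates G A B R := by
  obtain ⟨D, h1, h2, h3, h4⟩ := h
  obtain ⟨E, g1, g2, g3, g4⟩ := hR
  rw [Set.disjoint_left] at h2 h3 g2 g3
  refine ⟨D ∩ E, fun a ha => ⟨h1 ⟨ha.1, g3 (g1 ha)⟩, g1 ha⟩, ?_, ?_, ?_⟩
  · rw [Set.disjoint_left]; exact fun a ha => g2 ha.2
  · rw [Set.disjoint_left]; exact fun a ha => h3 ha.1
  · intro a ha b hab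
    rcases g4 a ha.2 b hab with hb | hb
    · rcases h4 a ha.1 b hab with hb' | hb'
      exacts [Or.inl ⟨hb', hb⟩, (g3 hb hb').elim]
    · exact Or.inr hb

theorem Linked.mono {G H : SimpleGraph α} {A B : Set α} {k : ℕ} (hGH : G ≤ H)
    (h : Linked G A B k) : Linked H A B k := by
  obtain ⟨u, v, w, hu, hv, hw, hd⟩ := h
  exact ⟨u, v, fun i => (w i).mapLe hGH, hu, hv, fun i => (hw i).mapLe hGH,
    fun i j z hi hj => hd i j z (by simpa using hi) (by simpa using hj)⟩

/-- A path whose vertices in `S` can only be its last vertex stays on its side of a cut. -/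
theorem mem_of_isPath_of_cut {G : SimpleGraph α} {D S : Set α}
    (hD : ∀ a ∈ D, ∀ b, G.Adj a b → b ∈ D ∨ b ∈ S) {u v : α} (w : G.Walk u v)
    (hw : w.IsPath) (hS : ∀ z ∈ w.support, z ∈ S → z = v) (hu : u ∈ D ∨ u = v) :
    ∀ z ∈ w.support, z ∈ D ∨ z = v := by
  induction w with
  | nil => intro z hz; right; simpa using hz
  | @cons a b c h p ih =>
    rw [Walk.cons_isPath_iff] at hw
    have hac : a ≠ c := fun e => hw.2 (e ▸ p.end_mem_support)
    have ha : a ∈ D := hu.resolve_right hac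
    intro z hz
    rw [Walk.support_cons, List.mem_cons] at hz
    rcases hz with rfl | hz
    · exact Or.inl ha
    · refine ih hw.1 (fun z hz => hS z (by simp [hz])) ?_ z hz
      rcases hD a ha b h with hb | hb
      exacts [Or.inl hb, Or.inr (hS b (by simp) hb)]

/-- In a linkage onto a set of the same size, the only vertex of that set on a path is its end. -/
theorem exists_end_eq [Finite α] {G : SimpleGraph α} {P : Set α} {k : ℕ} {u v : Fin k → α}
    {w : ∀ i, G.Walk (u i) (v i)} (hv : ∀ i, v i ∈ P)
    (hd : ∀ i j z, z ∈ (w i).support → z ∈ (w j).support → i = j) (hP : P.ncard ≤ k) :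
    (∀ s ∈ P, ∃ i, v i = s) ∧ ∀ i, ∀ z ∈ (w i).support, z ∈ P → z = v i := by
  have hinj : Function.Injective v := fun i j hij =>
    hd i j (v i) (w i).end_mem_support (by rw [hij]; exact (w j).end_mem_support)
  have hr : Set.range v = P := by
    refine Set.eq_of_subset_of_ncard_le (by rintro _ ⟨i, rfl⟩; exact hv i) ?_
    rw [← Set.image_univ, Set.ncard_image_of_injective _ hinj]
    simpa using hP
  have h1 : ∀ s ∈ P, ∃ i, v i = s := fun s hs => by rwa [← hr] at hs
  refine ⟨h1, fun i z hz hzP => ?_⟩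
  obtain ⟨j, rfl⟩ := h1 z hzP
  rw [hd i j _ hz (w j).end_mem_support]

theorem menger [Finite α] (G : SimpleGraph α) (A B : Set α) (k : ℕ)
    (h : ∀ S : Set α, Separates G A B S → k ≤ S.ncard) : Linked G A B k := by
  induction G using WellFoundedLT.induction generalizing A B with
  | ind G ih =>
  by_cases hG : G = ⊥
  · subst hG
    have hk := h (A ∩ B) ⟨A \ B, fun a ha => ⟨ha.1, fun hB => ha.2 ⟨ha.1, hB⟩⟩,
      Set.disjoint_left.2 fun a ha h => ha.2 h.2, Set.disjoint_left.2 fun a ha => ha.2, by simp⟩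
    obtain ⟨T, hT, hTk⟩ := Set.exists_subset_card_eq hk
    have e : Fin k ≃ T := (finCongr hTk.symm).trans (Finite.equivFin T).symm
    refine ⟨fun i => e i, fun i => e i, fun i => Walk.nil, fun i => (hT (e i).2).1,
      fun i => (hT (e i).2).2, fun i => by simp, fun i j z hi hj => ?_⟩
    simp only [Walk.support_nil, List.mem_singleton] at hi hj
    exact e.injective (Subtype.ext (hi.symm.trans hj))
  obtain ⟨x₀, y₀, hxy₀⟩ := SimpleGraph.ne_bot_iff_exists_adj.mp hG
  set G' := G.deleteEdges {s(x₀, y₀)} with hG'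
  have hle : G' ≤ G := G.deleteEdges_le _
  have hlt : G' < G := by
    refine lt_of_le_of_ne hle fun e => ?_
    rw [← e] at hxy₀
    simp [hG'] at hxy₀
  by_cases hS : ∀ S : Set α, Separates G' A B S → k ≤ S.ncard
  · exact (ih G' hlt A B hS).mono hle
  push Not at hS
  obtain ⟨S, ⟨D, h1, h2, h3, h4⟩, hSk⟩ := hS
  obtain ⟨x, y, hx, hy, hxy, hadj⟩ : ∃ x y, x ∈ D ∧ y ∉ D ∧ G.Adj x y ∧
      ∀ a b, G.Adj a b → G'.Adj a b ∨ (a = x ∧ b = y) ∨ (a = y ∧ b = x) := by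
    have key : ∀ a b, G.Adj a b → G'.Adj a b ∨ (a = x₀ ∧ b = y₀) ∨ (a = y₀ ∧ b = x₀) := by
      intro a b hab
      simp only [hG', deleteEdges_adj, Set.mem_singleton_iff, Sym2.eq_iff]
      tauto
    by_cases hx : x₀ ∈ D <;> by_cases hy : y₀ ∈ D
    · exact absurd (h S ⟨D, h1, h2, h3, fun a ha b hab => by
        rcases key a b hab with h | ⟨rfl, rfl⟩ | ⟨rfl, rfl⟩
        exacts [h4 a ha b h, Or.inl hy, Or.inl hx]⟩) hSk.not_ge
    · exact ⟨x₀, y₀, hx, hy, hxy₀, key⟩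
    · exact ⟨y₀, x₀, hy, hx, hxy₀.symm, fun a b hab => by have := key a b hab; tauto⟩
    · exact absurd (h S ⟨D, h1, h2, h3, fun a ha b hab => by
        rcases key a b hab with h | ⟨rfl, rfl⟩ | ⟨rfl, rfl⟩
        exacts [h4 a ha b h, (hx ha).elim, (hy ha).elim]⟩) hSk.not_ge
  rw [Set.disjoint_left] at h2 h3
  have hQ : Separates G A B (insert y S) := by
    refine ⟨D, fun a ha => h1 ⟨ha.1, fun h => ha.2 (Or.inr h)⟩, ?_, ?_, ?_⟩
    · rw [Set.disjoint_left]
      rintro a ha (h | h)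
      exacts [hy (h ▸ ha), h2 ha h]
    · rw [Set.disjoint_left]; exact fun a ha => h3 ha
    · rintro a ha b hab
      rcases hadj a b hab with h | ⟨rfl, rfl⟩ | ⟨rfl, rfl⟩
      · rcases h4 a ha b h with hb | hb
        exacts [Or.inl hb, Or.inr (Or.inr hb)]
      · exact Or.inr (Or.inl rfl)
      · exact Or.inl hx
  have hPk : (insert x S).ncard ≤ k := (Set.ncard_insert_le _ _).trans hSk
  have hQk : (insert y S).ncard ≤ k := (Set.ncard_insert_le _ _).trans hSk
  have hyS : y ∉ S := fun hyS => by
    have := h _ hQ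
    rw [Set.insert_eq_of_mem hyS] at this
    omega
  have hAP : ∀ R, Separates G' A (insert x S) R → k ≤ R.ncard := by
    rintro R ⟨E, g1, g2, g3, g4⟩
    rw [Set.disjoint_left] at g2 g3
    refine h R ⟨D ∩ E, fun a ha => ⟨h1 ⟨ha.1, fun h => g3 (g1 ha) (Or.inr h)⟩, g1 ha⟩, ?_, ?_, ?_⟩
    · rw [Set.disjoint_left]; exact fun a ha => g2 ha.2
    · rw [Set.disjoint_left]; exact fun a ha => h3 ha.1
    · rintro a ⟨ha, haE⟩ b hab
      rcases hadj a b hab with h | ⟨rfl, rfl⟩ | ⟨rfl, rfl⟩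
      · rcases g4 a haE b h with hb | hb
        · rcases h4 a ha b h with hb' | hb'
          exacts [Or.inl ⟨hb', hb⟩, (g3 hb (Or.inr hb')).elim]
        · exact Or.inr hb
      · exact (g3 haE (Or.inl rfl)).elim
      · exact (hy ha).elim
  have h4' : ∀ a ∈ (D ∪ S)ᶜ, ∀ b, G'.Adj a b → b ∈ (D ∪ S)ᶜ ∨ b ∈ S := by
    intro a ha b hab
    by_contra! hb
    have hbD : b ∈ D := by
      by_contra hD
      exact hb.1 (by rintro (h | h); exacts [hD h, hb.2 h])
    exact ha (h4 b hbD a hab.symm)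
  have hBQ : ∀ R, Separates G' B (insert y S) R → k ≤ R.ncard := by
    rintro R ⟨E, g1, g2, g3, g4⟩
    rw [Set.disjoint_left] at g2 g3
    refine h R (Separates.symm ⟨Dᶜ ∩ E, fun b hb => ⟨fun hD => h3 hD hb.1, g1 hb⟩, ?_, ?_, ?_⟩)
    · rw [Set.disjoint_left]; exact fun a ha => g2 ha.2
    · rw [Set.disjoint_left]
      exact fun a ha haA => ha.1 (h1 ⟨haA, fun h => g3 ha.2 (Or.inr h)⟩)
    · rintro a ⟨ha, haE⟩ b hab
      rcases hadj a b hab with h | ⟨rfl, rfl⟩ | ⟨rfl, rfl⟩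
      · rcases g4 a haE b h with hb | hb
        · rcases h4' a (by rintro (h | h); exacts [ha h, g3 haE (Or.inr h)]) b h with hb' | hb'
          exacts [Or.inl ⟨fun h => hb' (Or.inl h), hb⟩, (g3 hb (Or.inr hb')).elim]
        · exact Or.inr hb
      · exact (ha hx).elim
      · exact (g3 haE (Or.inl rfl)).elim
  obtain ⟨u, v, w, hu, hv, hw, hd⟩ := ih G' hlt A _ hAP
  obtain ⟨u', v', w', hu', hv', hw', hd'⟩ := ih G' hlt B _ hBQ
  obtain ⟨-, e2⟩ := exists_end_eq hv hd hPk
  obtain ⟨e1', e2'⟩ := exists_end_eq hv' hd' hQk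
  have hside : ∀ i, ∀ z ∈ (w i).support, z ∈ D ∨ z = v i := fun i => by
    refine mem_of_isPath_of_cut h4 (w i) (hw i) (fun z hz hzS => e2 i z hz (Or.inr hzS)) ?_
    by_cases hS : u i ∈ S
    · exact Or.inr (e2 i _ (w i).start_mem_support (Or.inr hS))
    · exact Or.inl (h1 ⟨hu i, hS⟩)
  have hside' : ∀ i, ∀ z ∈ (w' i).support, z ∈ (D ∪ S)ᶜ ∨ z = v' i := fun i => by
    refine mem_of_isPath_of_cut h4' (w' i) (hw' i) (fun z hz hzS => e2' i z hz (Or.inr hzS)) ?_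
    by_cases hS : u' i ∈ S
    · exact Or.inr (e2' i _ (w' i).start_mem_support (Or.inr hS))
    · exact Or.inl (by rintro (h | h); exacts [h3 h (hu' i), hS h])
  have hcross : ∀ i j z, z ∈ (w i).support → z ∈ (w' j).support → z ∈ S := by
    intro i j z hi hj
    rcases hside i z hi with hz | rfl
    · rcases hside' j z hj with hz' | rfl
      · exact (hz' (Or.inl hz)).elim
      · rcases hv' j with h | h
        exacts [(hy (h ▸ hz)).elim, h]
    · rcases hv i with h | h
      · rcases hside' j _ hj with hz' | hz'
        · exact (hz' (Or.inl (h ▸ hx))).elim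
        · rcases hv' j with h' | h'
          · exact absurd (h.symm.trans (hz'.trans h')) (G.ne_of_adj hxy)
          · exact hz' ▸ h'
      · exact h
  have hJ : ∀ i, ∃ j, (v i ∈ S ∧ v' j = v i) ∨ (v i = x ∧ v' j = y) := by
    intro i
    rcases hv i with h | h
    · obtain ⟨j, hj⟩ := e1' y (Or.inl rfl)
      exact ⟨j, Or.inr ⟨h, hj⟩⟩
    · obtain ⟨j, hj⟩ := e1' (v i) (Or.inr h)
      exact ⟨j, Or.inl ⟨h, hj⟩⟩
  choose J hJ using hJ
  have hvinj : ∀ i j, v i = v j → i = j := fun i j hij =>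
    hd i j (v i) (w i).end_mem_support (by rw [hij]; exact (w j).end_mem_support)
  have hJinj : ∀ i j, J i = J j → i = j := by
    intro i j hij
    apply hvinj
    rcases hJ i with ⟨a, b⟩ | ⟨a, b⟩ <;> rcases hJ j with ⟨c, d⟩ | ⟨c, d⟩
    · rw [← b, ← d, hij]
    · rw [← b, hij, d] at a; exact (hyS a).elim
    · rw [← d, ← hij, b] at c; exact (hyS c).elim
    · rw [a, c]
  have hW : ∀ i, ∃ W : G.Walk (u i) (u' (J i)), W.IsPath ∧
      ∀ z ∈ W.support, z ∈ (w i).support ∨ z ∈ (w' (J i)).support := by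
    classical
    intro i
    have hq : ∃ q : G.Walk (v i) (v' (J i)),
        ∀ z ∈ q.support, z ∈ (w i).support ∨ z ∈ (w' (J i)).support := by
      rcases hJ i with ⟨a, b⟩ | ⟨a, b⟩
      · refine ⟨(Walk.nil : G.Walk (v i) (v i)).copy rfl b.symm, fun z hz => ?_⟩
        rw [Walk.support_copy, Walk.support_nil, List.mem_singleton] at hz
        subst hz
        simp
      · have : G.Adj (v i) (v' (J i)) := by rw [a, b]; exact hxy
        refine ⟨this.toWalk, fun z hz => ?_⟩
        simp only [Walk.support_cons, Walk.support_nil, List.mem_cons, List.not_mem_nil,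
          or_false] at hz
        rcases hz with rfl | rfl <;> simp
    obtain ⟨q, hq⟩ := hq
    refine ⟨((((w i).mapLe hle).append q).append ((w' (J i)).reverse.mapLe hle)).bypass,
      Walk.bypass_isPath _, fun z hz => ?_⟩
    have := Walk.support_bypass_subset_support _ hz
    simp only [Walk.mem_support_append_iff, Walk.support_mapLe_eq_support, Walk.support_reverse,
      List.mem_reverse] at this
    rcases this with (h | h) | h
    exacts [Or.inl h, hq z h, Or.inr h]
  choose W hWp hWs using hW
  have hcr : ∀ i j z, z ∈ (w i).support → z ∈ (w' (J j)).support → i = j := by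
    intro i j z hi hj
    have hzS := hcross _ _ _ hi hj
    have a := e2 i z hi (Or.inr hzS)
    have b := e2' (J j) z hj (Or.inr hzS)
    apply hvinj
    rcases hJ j with ⟨c, d⟩ | ⟨c, d⟩
    · rw [← d, ← b, a]
    · rw [b, d] at hzS; exact (hyS hzS).elim
  refine ⟨u, fun i => u' (J i), W, hu, fun i => hu' _, hWp, fun i j z hi hj => ?_⟩
  rcases hWs i z hi with a | a <;> rcases hWs j z hj with b | b
  · exact hd i j z a b
  · exact hcr i j z a b
  · exact (hcr j i z b a).symm
  · exact hJinj i j (hd' _ _ z a b)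

theorem ConnSet.connected_induce {G : SimpleGraph α} {C : Set α} (h : ConnSet G C) :
    (G.induce C).Connected := by
  obtain ⟨x, hx⟩ := h.1
  have key : ∀ y : C, (G.induce C).Reachable ⟨x, hx⟩ y := by
    have hC : C ⊆ {y | ∃ hy : y ∈ C, (G.induce C).Reachable ⟨x, hx⟩ ⟨y, hy⟩} := by
      refine h.2 _ (fun y hy => hy.1) ⟨x, hx, Reachable.refl _⟩ ?_
      rintro a ⟨ha, hxa⟩ b hb hab
      exact ⟨hb, hxa.trans (Adj.reachable (by simpa using hab))⟩
    exact fun y => (hC y.2).2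
  have : Nonempty C := ⟨⟨x, hx⟩⟩
  exact ⟨fun a b => (key a).symm.trans (key b)⟩

theorem ConnSet.mono {G H : SimpleGraph α} {C : Set α} (hGH : G ≤ H) (h : ConnSet G C) :
    ConnSet H C :=
  ⟨h.1, fun D hD hne hcl => h.2 D hD hne fun a ha b hb hab => hcl a ha b hb (hGH hab)⟩

theorem connSet_singleton (G : SimpleGraph α) (x : α) : ConnSet G {x} := by
  refine ⟨⟨x, rfl⟩, fun D hD ⟨d, hd⟩ _ => ?_⟩
  obtain rfl : d = x := hD hd
  rintro _ rfl
  exact hd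

theorem ConnSet.subset_of_closed {G : SimpleGraph α} {C D : Set α} (h : ConnSet G C)
    (hne : (C ∩ D).Nonempty) (hD : ∀ a ∈ C, a ∈ D → ∀ b ∈ C, G.Adj a b → b ∈ D) : C ⊆ D :=
  fun _ hx => (h.2 (C ∩ D) Set.inter_subset_left hne
    (fun a ha b hb hab => ⟨hb, hD a ha.1 ha.2 b hb hab⟩) hx).2

theorem ConnSet.union {G : SimpleGraph α} {A B : Set α} (hA : ConnSet G A) (hB : ConnSet G B)
    {a b : α} (ha : a ∈ A) (hb : b ∈ B) (hab : G.Adj a b) : ConnSet G (A ∪ B) := by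
  refine ⟨⟨a, Or.inl ha⟩, fun D hD ⟨d, hd⟩ hcl => ?_⟩
  have hA' : (A ∩ D).Nonempty → A ⊆ D := fun hne =>
    hA.subset_of_closed hne fun x _ hx y hy hxy => hcl x hx y (Or.inl hy) hxy
  have hB' : (B ∩ D).Nonempty → B ⊆ D := fun hne =>
    hB.subset_of_closed hne fun x _ hx y hy hxy => hcl x hx y (Or.inr hy) hxy
  rcases hD hd with h | h
  · have h1 := hA' ⟨d, h, hd⟩
    exact Set.union_subset h1 (hB' ⟨b, hb, hcl a (h1 ha) b (Or.inr hb) hab⟩)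
  · have h1 := hB' ⟨d, h, hd⟩
    exact Set.union_subset (hA' ⟨a, ha, hcl b (h1 hb) a (Or.inl ha) hab.symm⟩) h1

theorem ConnSet.exists_spanning_tree {G : SimpleGraph α} {W : Set α} (h : ConnSet G W) :
    ∃ T : G.Subgraph, T.verts = W ∧ T.coe.IsTree := by
  obtain ⟨T, hT, hTree⟩ := h.connected_induce.exists_isTree_le
  let S : G.Subgraph :=
    { verts := W
      Adj := fun a b => ∃ (ha : a ∈ W) (hb : b ∈ W), T.Adj ⟨a, ha⟩ ⟨b, hb⟩
      adj_sub := fun ⟨_, _, hab⟩ => by simpa using hT hab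
      edge_vert := fun ⟨ha, _, _⟩ => ha
      symm := ⟨fun _ _ ⟨ha, hb, hab⟩ => ⟨hb, ha, hab.symm⟩⟩ }
  refine ⟨S, rfl, ?_⟩
  have : S.coe = T := by
    ext a b
    exact ⟨fun ⟨_, _, hab⟩ => hab, fun hab => ⟨a.2, b.2, hab⟩⟩
  rw [this]
  exact hTree

/-- `C` is the vertex set of a component of `G - U`. -/
def IsComp (G : SimpleGraph α) (U C : Set α) : Prop :=
  ConnSet G C ∧ Disjoint C U ∧ ∀ a ∈ C, ∀ b, b ∉ U → G.Adj a b → b ∈ C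

theorem exists_isComp (G : SimpleGraph α) {U : Set α} {v : α} (hv : v ∉ U) :
    ∃ C, v ∈ C ∧ IsComp G U C := by
  let r : α → α → Prop := fun a b => G.Adj a b ∧ a ∉ U ∧ b ∉ U
  have : Std.Symm r := ⟨fun a b h => ⟨h.1.symm, h.2.2, h.2.1⟩⟩
  have hU : ∀ x, Relation.ReflTransGen r v x → x ∉ U := by
    intro x hx
    induction hx with
    | refl => exact hv
    | tail _ h _ => exact h.2.2
  have hclosed : ∀ a, Relation.ReflTransGen r v a → ∀ b, b ∉ U → G.Adj a b →
      Relation.ReflTransGen r v b := fun a ha b hb hab => ha.tail ⟨hab, hU a ha, hb⟩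
  refine ⟨{x | Relation.ReflTransGen r v x}, Relation.ReflTransGen.refl,
    ⟨⟨v, Relation.ReflTransGen.refl⟩, fun D hD ⟨d, hd⟩ hcl x hx => ?_⟩,
    Set.disjoint_left.2 hU, hclosed⟩
  have hdx : Relation.ReflTransGen r d x :=
    (Std.Symm.symm _ _ (show Relation.ReflTransGen r v d from hD hd)).trans hx
  clear hx
  induction hdx with
  | refl => exact hd
  | tail _ h ih => exact hcl _ ih _ (hclosed _ (hD ih) _ h.2.2 h.1) h.1

/-- Removing one component of `W - w` from a connected set `W` leaves a connected set. -/
theorem ConnSet.diff_isComp {G : SimpleGraph α} {W D : Set α} {w : α} (hW : ConnSet G W)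
    (hw : w ∈ W) (hD : IsComp G (insert w Wᶜ) D) : ConnSet G (W \ D) := by
  obtain ⟨-, h2, h3⟩ := hD
  rw [Set.disjoint_left] at h2
  have hwD : w ∉ D := fun h => h2 h (Or.inl rfl)
  refine ⟨⟨w, hw, hwD⟩, fun E hE hne hcl => ?_⟩
  by_cases hwE : w ∈ E
  · have : W ⊆ E ∪ D := hW.subset_of_closed ⟨w, hw, Or.inl hwE⟩ fun a ha haE b hb hab => by
      by_cases hbD : b ∈ D
      · exact Or.inr hbD
      rcases haE with haE | haD
      · exact Or.inl (hcl a haE b ⟨hb, hbD⟩ hab)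
      · by_cases hbw : b = w
        · exact Or.inl (hbw ▸ hwE)
        · exact (hbD (h3 a haD b (by simp [hbw, hb]) hab)).elim
    exact fun x hx => (this hx.1).resolve_right hx.2
  · refine (hwE (hW.2 E (fun x hx => (hE hx).1) hne (fun a ha b hb hab => ?_) hw)).elim
    refine hcl a ha b ⟨hb, fun hbD => (hE ha).2 (h3 b hbD a ?_ hab.symm)⟩ hab
    rintro (rfl | h)
    exacts [hwE ha, h (hE ha).1]

/-- A connected set of maximum degree `3` with many vertices in `X` splits off a connected piece
with between `p` and `2 * p - 1` vertices in `X`, leaving a connected set. -/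
theorem ConnSet.exists_split [Finite α] {H : SimpleGraph α} {V : Set α} (X : Set α)
    (hV : ConnSet H V) (hdeg : ∀ v, (H.neighborSet v).ncard ≤ 3) {p : ℕ} (hp : 1 ≤ p)
    (hX : 3 * p - 1 ≤ (V ∩ X).ncard) :
    ∃ W ⊆ V, ConnSet H W ∧ ConnSet H (V \ W) ∧ p ≤ (W ∩ X).ncard ∧
      (W ∩ X).ncard ≤ 2 * p - 1 := by
  classical
  obtain ⟨W, ⟨hWV, hW, hWp, hWc⟩, hmin⟩ := (Set.toFinite {W : Set α | W ⊆ V ∧ ConnSet H W ∧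
    p ≤ (W ∩ X).ncard ∧ (W = V ∨ ConnSet H (V \ W))}).exists_minimal
    ⟨V, subset_rfl, hV, by omega, Or.inl rfl⟩
  have hsmall : ∀ w ∈ W, (W = V ∨ ∃ b ∈ V \ W, H.Adj w b) →
      ∀ D, IsComp H (insert w Wᶜ) D → (D ∩ X).ncard ≤ p - 1 := by
    intro w hw hwb D hD
    by_contra! hDp
    have hDW : D ⊆ W := fun d hd => by
      by_contra h
      exact Set.disjoint_left.1 hD.2.1 hd (Or.inr h)
    have hwD : w ∉ D := fun h => Set.disjoint_left.1 hD.2.1 h (Or.inl rfl)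
    have hc : ConnSet H (V \ D) := by
      have h1 := hW.diff_isComp hw hD
      rcases hWc with rfl | hWc
      · exact h1
      rcases hwb with rfl | ⟨b, hb, hwb⟩
      · exact h1
      · have h2 := h1.union hWc ⟨hw, hwD⟩ hb hwb
        convert h2 using 1
        ext x
        have := @hWV x
        have := @hDW x
        simp only [Set.mem_sdiff, Set.mem_union]
        tauto
    exact hwD (hmin ⟨hDW.trans hWV, hD.1, by omega, Or.inr hc⟩ hDW hw)
  have hcount : ∀ w ∈ W, (W = V ∨ ∃ b ∈ V \ W, H.Adj w b) →
      (W ∩ X).ncard ≤ (H.neighborSet w ∩ W).ncard * (p - 1) + 1 := by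
    intro w hw hwb
    have hcomp : ∀ b : α, ∃ D, b ∈ H.neighborSet w ∩ W → b ∈ D ∧ IsComp H (insert w Wᶜ) D := by
      intro b
      by_cases hb : b ∈ H.neighborSet w ∩ W
      · obtain ⟨D, hD⟩ := exists_isComp H (U := insert w Wᶜ) (v := b) (by
          rintro (rfl | h)
          exacts [hb.1.ne rfl, h hb.2])
        exact ⟨D, fun _ => hD⟩
      · exact ⟨∅, fun h => (hb h).elim⟩
    choose f hf using hcomp
    set N := (Set.toFinite (H.neighborSet w ∩ W)).toFinset with hN
    have hcover : W ∩ X ⊆ insert w (⋃ b ∈ N, (f b ∩ X)) := by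
      rintro x ⟨hxW, hxX⟩
      by_cases hxw : x = w
      · exact Or.inl hxw
      obtain ⟨D, hxD, hD⟩ := exists_isComp H (U := insert w Wᶜ) (v := x) (by simp [hxw, hxW])
      have hwD : w ∉ D := fun h => Set.disjoint_left.1 hD.2.1 h (Or.inl rfl)
      obtain ⟨b, hbD, hbw⟩ : ∃ b ∈ D, H.Adj w b := by
        by_contra! hno
        refine hwD (hW.subset_of_closed ⟨x, hxW, hxD⟩ (fun a _ haD b hb hab => ?_) hw)
        refine hD.2.2 a haD b ?_ hab
        rintro (rfl | h)
        exacts [hno a haD hab.symm, h hb]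
      have hbW : b ∈ W := by
        by_contra h
        exact Set.disjoint_left.1 hD.2.1 hbD (Or.inr h)
      obtain ⟨hbf, hfc⟩ := hf b ⟨hbw, hbW⟩
      have hsub : D ⊆ f b := hD.1.subset_of_closed ⟨b, hbD, hbf⟩ fun a _ haf c hc hac =>
        hfc.2.2 a haf c (Set.disjoint_left.1 hD.2.1 hc) hac
      refine Or.inr ?_
      simp only [Set.mem_iUnion]
      exact ⟨b, by simp [hN, hbW, hbw], hsub hxD, hxX⟩
    calc (W ∩ X).ncard ≤ (insert w (⋃ b ∈ N, (f b ∩ X))).ncard := Set.ncard_le_ncard hcover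
      _ ≤ (⋃ b ∈ N, (f b ∩ X)).ncard + 1 := Set.ncard_insert_le _ _
      _ ≤ (∑ b ∈ N, (f b ∩ X).ncard) + 1 := by
        gcongr; exact Finset.set_ncard_biUnion_le _ _
      _ ≤ N.card * (p - 1) + 1 := by
        gcongr
        refine Finset.sum_le_card_nsmul _ _ _ fun b hb => hsmall w hw hwb _ (hf b ?_).2
        simpa [hN] using hb
      _ = _ := by rw [hN, Set.ncard_eq_toFinset_card]
  have hWV' : W ≠ V := by
    rintro rfl
    obtain ⟨w, hw⟩ := hW.1
    have h1 := hcount w hw (Or.inl rfl)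
    have h2 : (H.neighborSet w ∩ W).ncard ≤ 3 :=
      (Set.ncard_le_ncard Set.inter_subset_left).trans (hdeg w)
    have h3 := Nat.mul_le_mul_right (p - 1) h2
    omega
  obtain ⟨w, hw, b, hb, hwb⟩ : ∃ w ∈ W, ∃ b ∈ V \ W, H.Adj w b := by
    by_contra! hno
    refine hWV' (hWV.antisymm (hV.2 W hWV hW.1 fun a ha b hb hab => ?_))
    by_contra hbW
    exact hno a ha b ⟨hb, hbW⟩ hab
  refine ⟨W, hWV, hW, hWc.resolve_left hWV', hWp, ?_⟩
  have h1 := hcount w hw (Or.inr ⟨b, hb, hwb⟩)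
  have h2 : (H.neighborSet w ∩ W).ncard ≤ 2 := by
    have : (H.neighborSet w ∩ W).ncard < (H.neighborSet w).ncard :=
      Set.ncard_lt_ncard ⟨Set.inter_subset_left, fun h => hb.2 (h hwb).2⟩
    have := hdeg w
    omega
  have h3 := Nat.mul_le_mul_right (p - 1) h2
  omega

theorem ConnSet.exists_pieces [Finite α] {H : SimpleGraph α} (X : Set α)
    (hdeg : ∀ v, (H.neighborSet v).ncard ≤ 3) {p : ℕ} (hp : 1 ≤ p) (n : ℕ) (V : Set α)
    (hV : ConnSet H V) (hX : n * (2 * p - 1) + p ≤ (V ∩ X).ncard) :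
    ∃ W : Fin (n + 1) → Set α, (∀ i, W i ⊆ V) ∧ (∀ i, ConnSet H (W i)) ∧
      (∀ i, p ≤ (W i ∩ X).ncard) ∧ Pairwise fun i j => Disjoint (W i) (W j) := by
  induction n generalizing V with
  | zero => exact ⟨fun _ => V, fun _ => subset_rfl, fun _ => hV, fun _ => by simpa using hX,
      fun i j hij => (hij (Subsingleton.elim (α := Fin 1) i j)).elim⟩
  | succ n ih =>
    have hmul : (n + 1) * (2 * p - 1) = n * (2 * p - 1) + (2 * p - 1) := by ring
    obtain ⟨W₀, hWV, hW, hVW, hWp, hWp'⟩ := hV.exists_split X hdeg hp (by omega)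
    have hcard : (V ∩ X).ncard ≤ (W₀ ∩ X).ncard + ((V \ W₀) ∩ X).ncard := by
      refine (Set.ncard_le_ncard ?_).trans (Set.ncard_union_le _ _)
      rintro x ⟨hx, hxX⟩
      by_cases h : x ∈ W₀
      exacts [Or.inl ⟨h, hxX⟩, Or.inr ⟨⟨hx, h⟩, hxX⟩]
    obtain ⟨W, h1, h2, h3, h4⟩ := ih (V \ W₀) hVW (by omega)
    have hdis : ∀ i, Disjoint W₀ (W i) := fun i =>
      Set.disjoint_left.2 fun x hx hxi => (h1 i hxi).2 hx
    refine ⟨Fin.cons W₀ W, ?_, ?_, ?_, ?_⟩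
    · intro i
      refine Fin.cases ?_ (fun i => ?_) i
      exacts [hWV, fun x hx => (h1 i hx).1]
    · intro i
      refine Fin.cases ?_ (fun i => ?_) i
      exacts [hW, h2 i]
    · intro i
      refine Fin.cases ?_ (fun i => ?_) i
      exacts [hWp, h3 i]
    · intro i j
      refine Fin.cases ?_ (fun i => ?_) i <;> refine Fin.cases ?_ (fun j => ?_) j
      · exact fun h => (h rfl).elim
      · exact fun _ => hdis j
      · exact fun _ => (hdis i).symm
      · exact fun h => h4 (fun e => h (congrArg Fin.succ e))

theorem Reachable.map_of_adj {β : Type*} {G : SimpleGraph α} {G' : SimpleGraph β} {f : α → β}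
    (hf : ∀ a b, G.Adj a b → G'.Reachable (f a) (f b)) {a b : α} (h : G.Reachable a b) :
    G'.Reachable (f a) (f b) := by
  obtain ⟨w⟩ := h
  induction w with
  | nil => exact Reachable.refl _
  | cons hab _ ih => exact (hf _ _ hab).trans ih

/-- The graph obtained from `T` by adding a new vertex adjacent to `t` only. -/
def addLeaf {ι : Type*} (T : SimpleGraph ι) (t : ι) : SimpleGraph (Option ι) where
  Adj
    | none, none => False
    | none, some s => s = t
    | some s, none => s = t
    | some a, some b => T.Adj a b
  symm := ⟨by rintro (_ | a) (_ | b) h <;> first | exact h | exact SimpleGraph.Adj.symm h⟩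
  loopless := ⟨by rintro (_ | a) h; exacts [h, T.loopless.irrefl a h]⟩

theorem isTree_addLeaf {ι : Type*} {T : SimpleGraph ι} (hT : T.IsTree) (t : ι) :
    (addLeaf T t).IsTree := by
  refine ⟨⟨fun x y => ?_⟩, ?_⟩
  · have h : ∀ x, (addLeaf T t).Reachable x (some t) := by
      rintro (_ | a)
      · exact Adj.reachable (show t = t from rfl)
      · exact Reachable.map_of_adj (f := some) (G := T)
          (fun a b hab => Adj.reachable (show T.Adj a b from hab)) (hT.connected.preconnected a t)
    exact (h x).trans (h y).symm
  · rw [isAcyclic_iff_forall_adj_isBridge]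
    have hleaf : (addLeaf T t).IsBridge s(none, some t) := by
      rw [isBridge_iff]
      rintro ⟨w⟩
      cases w with
      | @cons _ b _ h _ =>
        rw [deleteEdges_adj] at h
        cases b with
        | none => exact h.1
        | some b => exact h.2 (by rw [show b = t from h.1]; rfl)
    rintro (_ | a) (_ | b) hab
    · exact hab.elim
    · rw [show b = t from hab]; exact hleaf
    · rw [show a = t from hab, Sym2.eq_swap]; exact hleaf
    · have hbr := isAcyclic_iff_forall_adj_isBridge.mp hT.isAcyclic (show T.Adj a b from hab)
      rw [isBridge_iff] at hbr ⊢
      refine fun h => hbr (Reachable.map_of_adj (f := fun x => x.getD t) ?_ h)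
      rintro (_ | x) (_ | y) hxy
      · exact Reachable.refl _
      · rw [deleteEdges_adj] at hxy
        obtain rfl : y = t := hxy.1
        exact Reachable.refl _
      · rw [deleteEdges_adj] at hxy
        obtain rfl : x = t := hxy.1
        exact Reachable.refl _
      · rw [deleteEdges_adj] at hxy
        refine Adj.reachable ((deleteEdges_adj).mpr ⟨hxy.1, fun h => hxy.2 ?_⟩)
        simp only [Option.getD_some, Set.mem_singleton_iff, Sym2.eq_iff, Option.some.injEq] at h ⊢
        exact h

/-- The neighbourhood of a vertex set. -/
def nbhd (G : SimpleGraph α) (C : Set α) : Set α := {x | x ∉ C ∧ ∃ c ∈ C, G.Adj c x}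

/-- `H` is a connected subgraph of `G` on the vertex set `V` of maximum degree at most `3`, and
its vertices in `X` have degree at most `2`. -/
structure IsFrame (G : SimpleGraph α) (X V : Set α) (H : SimpleGraph α) : Prop where
  le : H ≤ G
  mem_of_adj : ∀ a b, H.Adj a b → a ∈ V
  conn : ConnSet H V
  subset : X ⊆ V
  deg_le : ∀ v, (H.neighborSet v).ncard ≤ 3
  deg_le_two : ∀ v ∈ X, (H.neighborSet v).ncard ≤ 2

/-- The neighbourhood of `C` is empty or the boundary of a premesh of order at most `h`. -/
def Premesh (G : SimpleGraph α) (C : Set α) (h : ℕ) : Prop :=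
  nbhd G C = ∅ ∨ ((nbhd G C).ncard ≤ h ∧ ∃ V H, IsFrame G (nbhd G C) V H ∧ Disjoint V C ∧
    ∃ x ∈ nbhd G C, (H.neighborSet x).ncard ≤ 1)

/-- `G[U]` has a tree decomposition into bags of size at most `m`, such that the neighbourhood of
each component of `G - U` lies in a bag and bounds a premesh of order at most `h`. -/
def PartialDecomp (G : SimpleGraph α) (m h : ℕ) (U : Set α) : Prop :=
  ∃ (ι : Type) (T : SimpleGraph ι) (B : ι → Set α), T.IsTree ∧ (∀ t, B t ⊆ U) ∧
    (∀ t, (B t).ncard ≤ m) ∧ (∀ a ∈ U, ∀ b ∈ U, G.Adj a b → ∃ t, a ∈ B t ∧ b ∈ B t) ∧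
    (∀ v ∈ U, ConnSet T {t | v ∈ B t}) ∧
    ∀ C, IsComp G U C → (∃ t, nbhd G C ⊆ B t) ∧ Premesh G C h

theorem IsComp.subset_or_disjoint {G : SimpleGraph α} {U C S C' : Set α} (hC : IsComp G U C)
    (hS : S ⊆ C) (hC' : IsComp G (U ∪ S) C') : C' ⊆ C ∨ IsComp G U C' := by
  have hd := Set.disjoint_left.1 hC'.2.1
  by_cases hne : (C' ∩ C).Nonempty
  · exact Or.inl (hC'.1.subset_of_closed hne fun a _ ha b hb hab =>
      hC.2.2 a ha b (fun hbU => hd hb (Or.inl hbU)) hab)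
  · refine Or.inr ⟨hC'.1, Set.disjoint_left.2 fun a ha haU => hd ha (Or.inl haU),
      fun a ha b hb hab => hC'.2.2 a ha b ?_ hab⟩
    rintro (h | h)
    · exact hb h
    · exact hne ⟨a, ha, hC.2.2 b (hS h) a (fun haU => hd ha (Or.inl haU)) hab.symm⟩

theorem IsComp.nbhd_subset {G : SimpleGraph α} {U C : Set α} (hC : IsComp G U C) :
    nbhd G C ⊆ U := by
  rintro x ⟨hx, c, hc, hcx⟩
  by_contra hxU
  exact hx (hC.2.2 c hc x hxU hcx)

theorem IsComp.nbhd_subset_union {G : SimpleGraph α} {U C S C' : Set α} (hC : IsComp G U C)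
    (hC' : IsComp G (U ∪ S) C') (hsub : C' ⊆ C) : nbhd G C' ⊆ nbhd G C ∪ S := by
  intro x hx
  obtain ⟨-, c, hc, hcx⟩ := id hx
  rcases hC'.nbhd_subset hx with h | h
  · exact Or.inl ⟨fun hxC => Set.disjoint_left.1 hC.2.1 hxC h, c, hsub hc, hcx⟩
  · exact Or.inr h

theorem PartialDecomp.extend {G : SimpleGraph α} {m h : ℕ} {U C S : Set α}
    (hU : PartialDecomp G m h U) (hC : IsComp G U C) (hS : S ⊆ C)
    (hm : (nbhd G C ∪ S).ncard ≤ m)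
    (hpre : ∀ C', IsComp G (U ∪ S) C' → C' ⊆ C → Premesh G C' h) :
    PartialDecomp G m h (U ∪ S) := by
  obtain ⟨ι, T, B, hT, hBU, hBm, hBe, hBc, hBC⟩ := hU
  obtain ⟨t, ht⟩ := (hBC C hC).1
  have hCU := Set.disjoint_left.1 hC.2.1
  have hN : ∀ a ∈ U, ∀ b ∈ S, G.Adj a b → a ∈ nbhd G C := fun a ha b hb hab =>
    ⟨fun h => hCU h ha, b, hS hb, hab.symm⟩
  refine ⟨Option ι, addLeaf T t, fun x => x.elim (nbhd G C ∪ S) B, isTree_addLeaf hT t,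
    ?_, ?_, ?_, ?_, ?_⟩
  · rintro (_ | s)
    · exact Set.union_subset_union_left _ hC.nbhd_subset
    · exact (hBU s).trans Set.subset_union_left
  · rintro (_ | s)
    exacts [hm, hBm s]
  · rintro a (ha | ha) b (hb | hb) hab
    · obtain ⟨s, hs⟩ := hBe a ha b hb hab
      exact ⟨some s, hs⟩
    · exact ⟨none, Or.inl (hN a ha b hb hab), Or.inr hb⟩
    · exact ⟨none, Or.inr ha, Or.inl (hN b hb a ha hab.symm)⟩
    · exact ⟨none, Or.inr ha, Or.inr hb⟩
  · intro v hv
    have hold : v ∈ U → ConnSet (addLeaf T t) (some '' {s | v ∈ B s}) := by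
      intro hvU
      obtain ⟨⟨s, hs⟩, hcl⟩ := hBc v hvU
      refine ⟨⟨some s, s, hs, rfl⟩, fun D hD ⟨d, hd⟩ hDcl => ?_⟩
      obtain ⟨d', hd', rfl⟩ := hD hd
      have := hcl {s | v ∈ B s ∧ some s ∈ D} (fun s hs => hs.1) ⟨d', hd', hd⟩
        fun a ha b hb hab => ⟨hb, hDcl _ ha.2 (some b) ⟨b, hb, rfl⟩ hab⟩
      rintro _ ⟨s, hs, rfl⟩
      exact (this hs).2
    by_cases hvX : v ∈ nbhd G C ∪ S
    · have heq : {x : Option ι | v ∈ (x.elim (nbhd G C ∪ S) B : Set α)} =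
          {none} ∪ some '' {s | v ∈ B s} := by
        ext (_ | s)
        · simpa using hvX
        · simp
      rw [heq]
      by_cases hvU : v ∈ U
      · have hvN : v ∈ nbhd G C := hvX.resolve_right fun h => hCU (hS h) hvU
        exact (connSet_singleton _ _).union (hold hvU) rfl ⟨t, ht hvN, rfl⟩
          (show t = t from rfl)
      · have : {s | v ∈ B s} = ∅ := Set.eq_empty_of_forall_notMem fun s hs => hvU (hBU s hs)
        rw [this, Set.image_empty, Set.union_empty]
        exact connSet_singleton _ _
    · have heq : {x : Option ι | v ∈ (x.elim (nbhd G C ∪ S) B : Set α)} =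
          some '' {s | v ∈ B s} := by
        ext (_ | s)
        · simpa using hvX
        · simp
      rw [heq]
      exact hold (hv.resolve_right fun h => hvX (Or.inr h))
  · intro C' hC'
    rcases hC.subset_or_disjoint hS hC' with hsub | hcomp
    · exact ⟨⟨none, hC.nbhd_subset_union hC' hsub⟩, hpre C' hC' hsub⟩
    · obtain ⟨⟨s, hs⟩, hp⟩ := hBC C' hcomp
      exact ⟨⟨some s, hs⟩, hp⟩

theorem partialDecomp_empty [Finite α] (G : SimpleGraph α) (m h : ℕ) :
    PartialDecomp G m h ∅ := by
  refine ⟨Unit, ⊥, fun _ => ∅, IsTree.of_subsingleton, by simp, by simp, by simp, by simp, ?_⟩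
  intro C hC
  have : nbhd G C = ∅ := Set.subset_eq_empty hC.nbhd_subset rfl
  exact ⟨⟨(), by rw [this]⟩, Or.inl this⟩

theorem PartialDecomp.treewidth_le {α : Type} {G : SimpleGraph α} {m h : ℕ}
    (hG : PartialDecomp G (m + 1) h Set.univ) : treewidth G ≤ m := by
  obtain ⟨ι, T, B, hT, -, hBm, hBe, hBc, -⟩ := hG
  refine Nat.sInf_le ⟨ι, T, B, hT, ⟨fun v => (hBc v trivial).1,
    fun a b hab => hBe a trivial b trivial hab,
    fun v => (hBc v trivial).connected_induce⟩, hBm⟩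

theorem ncard_neighborSet_toSubgraph_le_two {G : SimpleGraph α} {u v : α} {p : G.Walk u v}
    (hp : p.IsPath) (x : α) : (p.toSubgraph.neighborSet x).ncard ≤ 2 ∧
      (x = u ∨ x = v → (p.toSubgraph.neighborSet x).ncard ≤ 1) := by
  by_cases hn : p.Nil
  · have : p.toSubgraph.neighborSet x = ∅ := by
      cases hn
      ext y
      simp
    simp [this]
  by_cases hx : x ∈ p.support
  · have h1 : x = u ∨ x = v → (p.toSubgraph.neighborSet x).ncard ≤ 1 := by
      rintro (rfl | rfl)
      · rw [hp.neighborSet_toSubgraph_startpoint hn, Set.ncard_singleton]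
      · rw [hp.neighborSet_toSubgraph_endpoint hn, Set.ncard_singleton]
    refine ⟨?_, h1⟩
    obtain ⟨n, rfl, hnl⟩ := Walk.mem_support_iff_exists_getVert.mp hx
    rcases Nat.eq_zero_or_pos n with rfl | hn0
    · exact (h1 (Or.inl (by simp))).trans one_le_two
    rcases hnl.eq_or_lt with rfl | hlt
    · exact (h1 (Or.inr (by simp))).trans one_le_two
    · exact (hp.ncard_neighborSet_toSubgraph_internal_eq_two hn0.ne' hlt).le
  · have : p.toSubgraph.neighborSet x = ∅ := by
      ext y
      simp only [Subgraph.mem_neighborSet, Set.mem_empty_iff_false, iff_false]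
      intro h
      exact hx (by simpa using p.toSubgraph.edge_vert h)
    simp [this]

theorem ConnSet.attach_paths {G H : SimpleGraph α} {V : Set α} {ι : Type*} {u v : ι → α}
    (hc : ConnSet H V) (w : ∀ i, G.Walk (u i) (v i)) (hu : ∀ i, u i ∈ V) :
    ConnSet (H ⊔ ⨆ i, (w i).toSubgraph.spanningCoe) (V ∪ {z | ∃ i, z ∈ (w i).support}) := by
  refine ⟨hc.1.mono Set.subset_union_left, fun D hD ⟨d, hd⟩ hcl => ?_⟩
  have hpath : ∀ i, (∃ z ∈ (w i).support, z ∈ D) → ∀ z ∈ (w i).support, z ∈ D := by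
    intro i hz
    have hcl' : ∀ a b, (w i).toSubgraph.Adj a b → a ∈ D → b ∈ D := fun a b hab ha =>
      hcl a ha b (Or.inr ⟨i, by simpa using (w i).toSubgraph.edge_vert hab.symm⟩)
        (Or.inr (by simpa using ⟨i, hab⟩))
    have hstep : ∀ n, n < (w i).length → ((w i).getVert n ∈ D ↔ (w i).getVert (n + 1) ∈ D) :=
      fun n hn => ⟨hcl' _ _ ((w i).toSubgraph_adj_getVert hn),
        hcl' _ _ ((w i).toSubgraph_adj_getVert hn).symm⟩
    have hall : ∀ n, n ≤ (w i).length → ((w i).getVert n ∈ D ↔ (w i).getVert 0 ∈ D) := by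
      intro n
      induction n with
      | zero => simp
      | succ n ih => exact fun hn => (hstep n (by omega)).symm.trans (ih (by omega))
    obtain ⟨z, hz, hzD⟩ := hz
    obtain ⟨n, rfl, hn⟩ := Walk.mem_support_iff_exists_getVert.mp hz
    intro y hy
    obtain ⟨m, rfl, hm⟩ := Walk.mem_support_iff_exists_getVert.mp hy
    exact (hall m hm).2 ((hall n hn).1 hzD)
  have hne : (V ∩ D).Nonempty := by
    rcases hD hd with h | ⟨i, hi⟩
    · exact ⟨d, h, hd⟩
    · exact ⟨u i, hu i, hpath i ⟨d, hi, hd⟩ _ (w i).start_mem_support⟩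
  have hV : V ⊆ D := hc.subset_of_closed hne fun a _ haD b hb hab =>
    hcl a haD b (Or.inl hb) (Or.inl hab)
  rintro x (hx | ⟨i, hi⟩)
  · exact hV hx
  · exact hpath i ⟨u i, (w i).start_mem_support, hV (hu i)⟩ x hi

/-- Attaching disjoint paths, which start in `X` and are otherwise outside `V`, to a frame. -/
theorem IsFrame.attach_paths [Finite α] {G H : SimpleGraph α} {X V X' : Set α} {ι : Type*}
    {u v : ι → α} (hF : IsFrame G X V H) (w : ∀ i, G.Walk (u i) (v i)) (hw : ∀ i, (w i).IsPath)
    (hd : ∀ i j z, z ∈ (w i).support → z ∈ (w j).support → i = j) (hu : ∀ i, u i ∈ V)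
    (hu2 : ∀ i, (H.neighborSet (u i)).ncard ≤ 2)
    (hV : ∀ i, ∀ z ∈ (w i).support, z ∈ V → z = u i)
    (hX' : ∀ x ∈ X', (x ∈ X ∧ ∀ i, x = u i → (H.neighborSet x).ncard ≤ 1) ∨
      (x ∉ V ∧ ∃ i, x = v i)) :
    IsFrame G X' (V ∪ {z | ∃ i, z ∈ (w i).support}) (H ⊔ ⨆ i, (w i).toSubgraph.spanningCoe) ∧
    ∀ i, v i ∉ V →
      ((H ⊔ ⨆ i, (w i).toSubgraph.spanningCoe).neighborSet (v i)).ncard ≤ 1 := by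
  set H' := H ⊔ ⨆ i, (w i).toSubgraph.spanningCoe with hH'
  have hadj : ∀ a b, H'.Adj a b ↔ H.Adj a b ∨ ∃ i, (w i).toSubgraph.Adj a b := by
    intro a b; simp [hH']
  have hsupp : ∀ i a b, (w i).toSubgraph.Adj a b → a ∈ (w i).support := fun i a b h => by
    simpa using (w i).toSubgraph.edge_vert h
  have hoff : ∀ x ∈ V, (∀ i, x ≠ u i) → H'.neighborSet x = H.neighborSet x := by
    intro x hx hxu
    ext y
    simp only [mem_neighborSet, hadj, or_iff_left_iff_imp, forall_exists_index]
    exact fun i h => (hxu i (hV i x (hsupp i x y h) hx)).elim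
  have hon : ∀ i, ∀ x ∈ (w i).support,
      H'.neighborSet x = H.neighborSet x ∪ (w i).toSubgraph.neighborSet x := by
    intro i x hx
    ext y
    simp only [mem_neighborSet, hadj, Set.mem_union, Subgraph.mem_neighborSet]
    refine or_congr Iff.rfl ⟨?_, fun h => ⟨i, h⟩⟩
    rintro ⟨j, h⟩
    rw [hd i j x hx (hsupp j x y h)]
    exact h
  have hout : ∀ x, x ∉ V → H.neighborSet x = ∅ := fun x hx =>
    Set.eq_empty_of_forall_notMem fun y hy => hx (hF.mem_of_adj x y hy)
  have hstart : ∀ i, (H'.neighborSet (u i)).ncard ≤ (H.neighborSet (u i)).ncard + 1 := by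
    intro i
    rw [hon i _ (w i).start_mem_support]
    refine (Set.ncard_union_le _ _).trans (Nat.add_le_add_left ?_ _)
    exact (ncard_neighborSet_toSubgraph_le_two (hw i) _).2 (Or.inl rfl)
  have hend : ∀ i, v i ∉ V → (H'.neighborSet (v i)).ncard ≤ 1 := by
    intro i hi
    rw [hon i _ (w i).end_mem_support, hout _ hi, Set.empty_union]
    exact (ncard_neighborSet_toSubgraph_le_two (hw i) _).2 (Or.inr rfl)
  refine ⟨⟨?_, ?_, hF.conn.attach_paths w hu, ?_, ?_, ?_⟩, hend⟩
  · intro a b hab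
    rcases (hadj a b).1 hab with h | ⟨i, h⟩
    exacts [hF.le h, (w i).toSubgraph.adj_sub h]
  · intro a b hab
    rcases (hadj a b).1 hab with h | ⟨i, h⟩
    exacts [Or.inl (hF.mem_of_adj a b h), Or.inr ⟨i, hsupp i a b h⟩]
  · intro x hx
    rcases hX' x hx with h | ⟨-, i, rfl⟩
    exacts [Or.inl (hF.subset h.1), Or.inr ⟨i, (w i).end_mem_support⟩]
  · intro x
    by_cases hxV : x ∈ V
    · by_cases hxu : ∃ i, x = u i
      · obtain ⟨i, rfl⟩ := hxu
        have := hstart i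
        have := hu2 i
        omega
      · push Not at hxu
        rw [hoff x hxV hxu]
        exact hF.deg_le x
    · by_cases hxs : ∃ i, x ∈ (w i).support
      · obtain ⟨i, hi⟩ := hxs
        rw [hon i x hi, hout x hxV, Set.empty_union]
        exact (ncard_neighborSet_toSubgraph_le_two (hw i) x).1.trans (by omega)
      · have : H'.neighborSet x = ∅ := Set.eq_empty_of_forall_notMem fun y hy => by
          rcases (hadj x y).1 hy with h | ⟨i, h⟩
          exacts [hxV (hF.mem_of_adj x y h), hxs ⟨i, hsupp i x y h⟩]
        simp [this]
  · intro x hx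
    rcases hX' x hx with ⟨hxX, hxu⟩ | ⟨hxV, i, rfl⟩
    · by_cases hxu' : ∃ i, x = u i
      · obtain ⟨i, rfl⟩ := hxu'
        have := hstart i
        have := hxu i rfl
        omega
      · push Not at hxu'
        rw [hoff x (hF.subset hxX) hxu']
        exact hF.deg_le_two x hxX
    · exact (hend i hxV).trans one_le_two

theorem exists_path_trim {G : SimpleGraph α} {Z : Set α} {u v : α} (w : G.Walk u v)
    (hw : w.IsPath) (h : ∃ z ∈ w.support, z ∈ Z) :
    ∃ u' ∈ Z, ∃ w' : G.Walk u' v, w'.IsPath ∧ w'.support ⊆ w.support ∧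
      ∀ z ∈ w'.support, z ∈ Z → z = u' := by
  induction w with
  | nil =>
    obtain ⟨z, hz, hzZ⟩ := h
    obtain rfl : z = _ := by simpa using hz
    exact ⟨z, hzZ, .nil, hw, List.Subset.refl _, by simp⟩
  | @cons a b c hab p ih =>
    by_cases hp : ∃ z ∈ p.support, z ∈ Z
    · obtain ⟨u', hu', w', h1, h2, h3⟩ := ih hw.of_cons hp
      exact ⟨u', hu', w', h1, List.Subset.trans h2 (by simp), h3⟩
    · push Not at hp
      obtain ⟨z, hz, hzZ⟩ := h
      have key : ∀ y ∈ (Walk.cons hab p).support, y ∈ Z → y = a := by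
        intro y hy hyZ
        rw [Walk.support_cons, List.mem_cons] at hy
        exact hy.resolve_right fun hy => hp y hy hyZ
      obtain rfl := key z hz hzZ
      exact ⟨z, hzZ, _, hw, List.Subset.refl _, key⟩

/-- The subgraph of `G[C ∪ P]` of the edges with an end in `C`. -/
def restr (G : SimpleGraph α) (C P : Set α) : SimpleGraph α where
  Adj a b := G.Adj a b ∧ a ∈ C ∪ P ∧ b ∈ C ∪ P ∧ (a ∈ C ∨ b ∈ C)
  symm := ⟨fun _ _ h => ⟨h.1.symm, h.2.2.1, h.2.1, h.2.2.2.symm⟩⟩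
  loopless := ⟨fun _ h => h.1.ne rfl⟩

theorem restr_le (G : SimpleGraph α) (C P : Set α) : restr G C P ≤ G := fun _ _ h => h.1

theorem mem_of_mem_support_restr {G : SimpleGraph α} {C P : Set α} {u v : α}
    (w : (restr G C P).Walk u v) (hu : u ∈ C ∪ P) : ∀ z ∈ w.support, z ∈ C ∪ P := by
  induction w with
  | nil => simpa using hu
  | cons h p ih =>
    intro z hz
    rw [Walk.support_cons, List.mem_cons] at hz
    rcases hz with rfl | hz
    exacts [hu, ih h.2.2.1 z hz]

/-- A connected subset of `C` avoiding a separator has neighbours on one side of it only. -/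
theorem Separates.forall_not_adj_or {G : SimpleGraph α} {C Y Z S K : Set α}
    (h : Separates (restr G C (Y ∪ Z)) Y Z S) (hK : ConnSet G K) (hKC : K ⊆ C)
    (hKS : Disjoint K S) :
    (∀ y ∈ Y \ S, ∀ c ∈ K, ¬ G.Adj c y) ∨ ∀ z ∈ Z \ S, ∀ c ∈ K, ¬ G.Adj c z := by
  by_contra! hcon
  obtain ⟨⟨y, hy, c, hc, hcy⟩, z, hz, c', hc', hcz⟩ := hcon
  obtain ⟨D, hYD, -, hDZ, hD⟩ := h
  rw [Set.disjoint_left] at hKS hDZ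
  have hKD : K ⊆ D := by
    refine hK.subset_of_closed ⟨c, hc, ?_⟩ fun a ha haD b hb hab => ?_
    · exact (hD y (hYD hy) c ⟨hcy.symm, Or.inr (Or.inl hy.1), Or.inl (hKC hc),
        Or.inr (hKC hc)⟩).resolve_right (hKS hc)
    · exact (hD a haD b ⟨hab, Or.inl (hKC ha), Or.inl (hKC hb),
        Or.inr (hKC hb)⟩).resolve_right (hKS hb)
  rcases hD c' (hKD hc') z ⟨hcz, Or.inl (hKC hc'), Or.inr (Or.inr hz.1),
    Or.inl (hKC hc')⟩ with h | h
  exacts [hDZ h hz.1, hz.2 h]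

theorem IsComp.nbhd_inter_nonempty {G : SimpleGraph α} {U C S C' : Set α} (hC : IsComp G U C)
    (hS : S ⊆ C) (hS' : S.Nonempty) (hC' : IsComp G (U ∪ S) C') (hsub : C' ⊆ C) :
    (nbhd G C' ∩ S).Nonempty := by
  by_contra hne
  have hCC' : C ⊆ C' := by
    obtain ⟨c, hc⟩ := hC'.1.1
    refine hC.1.subset_of_closed ⟨c, hsub hc, hc⟩ fun a _ ha b hb hab => ?_
    by_contra hbC
    by_cases hbS : b ∈ S
    · exact hne ⟨b, ⟨hbC, a, ha, hab⟩, hbS⟩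
    · refine hbC (hC'.2.2 a ha b ?_ hab)
      rintro (h | h)
      exacts [Set.disjoint_left.1 hC.2.1 hb h, hbS h]
  obtain ⟨s, hs⟩ := hS'
  exact Set.disjoint_left.1 hC'.2.1 (hCC' (hS hs)) (Or.inr hs)

/-- A component of `C - S`, where `S` is a minimum separator of `Y` from `Z`, that has no
neighbours in `Z \ S` is bounded by a premesh. -/
theorem IsComp.premesh_of_separates [Finite α] {G H : SimpleGraph α} {U C C' V Y Z S : Set α}
    {h : ℕ} (hC : IsComp G U C) (hF : IsFrame G (nbhd G C) V H) (hVC : Disjoint V C)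
    (hZ : Z ⊆ nbhd G C)
    (hsep : Separates (restr G C (Y ∪ Z)) Y Z S)
    (hmin : ∀ R, Separates (restr G C (Y ∪ Z)) Y Z R → S.ncard ≤ R.ncard)
    (hSZ : S.ncard ≤ Z.ncard) (hh : (nbhd G C).ncard ≤ h)
    (hC' : IsComp G (U ∪ S ∩ C) C') (hsub : C' ⊆ C) (hS : (nbhd G C' ∩ (S ∩ C)).Nonempty)
    (hadj : ∀ z ∈ Z \ S, ∀ c ∈ C', ¬ G.Adj c z) : Premesh G C' h := by
  have hlink : Linked (restr G C (Y ∪ Z)) Z S S.ncard :=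
    menger _ _ _ _ fun R hR => hmin R (hsep.symm.trans hR).symm
  obtain ⟨u, v, w, hu, hv, hw, hd⟩ := hlink
  obtain ⟨hall, hend⟩ := exists_end_eq hv hd le_rfl
  choose u' hu' w' hw' hsupp htrim using fun i =>
    exists_path_trim (w i) (hw i) ⟨u i, (w i).start_mem_support, hu i⟩
  obtain ⟨D, hZD, hDS, hDY, hD⟩ := hsep.symm
  rw [Set.disjoint_left] at hDS hDY hVC
  have hC'US := Set.disjoint_left.1 hC'.2.1
  have hCU := Set.disjoint_left.1 hC.2.1
  have hZC : ∀ z ∈ Z, z ∉ C := fun z hz => (hZ hz).1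
  have hpath : ∀ i, ∀ z ∈ (w' i).support, z ∈ D \ C' ∨ z = v i := by
    intro i
    refine mem_of_isPath_of_cut (S := S) ?_ (w' i) (hw' i)
      (fun z hz => hend i z (hsupp i hz)) ?_
    · rintro a ⟨haD, haC'⟩ b hab
      rcases hD a haD b hab with hb | hb
      · refine Or.inl ⟨hb, fun hbC' => ?_⟩
        rcases hab.2.1 with haC | haY | haZ
        · refine haC' (hC'.2.2 b hbC' a ?_ hab.1.symm)
          rintro (haU | haS)
          exacts [hCU haC haU, hDS haD haS.1]
        · exact hDY haD haY
        · exact hadj a ⟨haZ, hDS haD⟩ b hbC' hab.1.symm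
      · exact Or.inr hb
    · by_cases h : u' i ∈ S
      · exact Or.inr (hend i _ (hsupp i (w' i).start_mem_support) h)
      · exact Or.inl ⟨hZD ⟨hu' i, h⟩, fun h => hZC _ (hu' i) (hsub h)⟩
  have hsupp' : ∀ i, ∀ z ∈ (w' i).support, z ∈ C ∪ (Y ∪ Z) := fun i =>
    mem_of_mem_support_restr (w' i) (Or.inr (Or.inr (hu' i)))
  have hN : nbhd G C' ⊆ nbhd G C ∪ S ∩ C := hC.nbhd_subset_union hC' hsub
  have hNZ : ∀ x ∈ nbhd G C', x ∈ Z → x ∈ S := by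
    rintro x ⟨-, c, hc, hcx⟩ hxZ
    by_contra hxS
    exact hadj x ⟨hxZ, hxS⟩ c hc hcx
  obtain ⟨hF', hF1⟩ := hF.attach_paths (ι := {i // v i ∈ C}) (X' := nbhd G C')
    (u := fun i => u' i) (v := fun i => v i) (fun i => (w' i).mapLe (restr_le G C _))
    (fun i => (hw' i).mapLe _)
    (fun i j z hi hj => Subtype.ext (hd i j z (hsupp i (by simpa using hi))
      (hsupp j (by simpa using hj))))
    (fun i => hF.subset (hZ (hu' i))) (fun i => hF.deg_le_two _ (hZ (hu' i)))
    (fun i z hz hzV => by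
      have hz : z ∈ (w' i).support := by simpa using hz
      have hzC : z ∉ C := hVC hzV
      rcases hsupp' i z hz with h | h | h
      · exact (hzC h).elim
      · rcases hpath i z hz with h' | h'
        · exact (hDY h'.1 h).elim
        · exact (hzC (h' ▸ i.2)).elim
      · exact htrim i z hz h)
    (fun x hx => by
      rcases hN hx with hxX | ⟨hxS, hxC⟩
      · refine Or.inl ⟨hxX, fun i hxi => ?_⟩
        have hxS : x ∈ S := hNZ x hx (hxi ▸ hu' i)
        have hxv := hend i x (hsupp i (hxi ▸ (w' i).start_mem_support)) hxS
        exact (hxX.1 (hxv ▸ i.2)).elim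
      · obtain ⟨i, rfl⟩ := hall x hxS
        exact Or.inr ⟨fun h => hVC h hxC, ⟨i, hxC⟩, rfl⟩)
  refine Or.inr ⟨?_, _, _, hF', ?_, ?_⟩
  · have h1 : nbhd G C' ⊆ (nbhd G C \ Z) ∪ S := by
      intro x hx
      by_cases hxZ : x ∈ Z
      · exact Or.inr (hNZ x hx hxZ)
      · rcases hN hx with h | h
        exacts [Or.inl ⟨h, hxZ⟩, Or.inr h.1]
    have h2 := Set.ncard_le_ncard h1
    have h3 := Set.ncard_union_le (nbhd G C \ Z) S
    have h4 := Set.ncard_sdiff_add_ncard_of_subset hZ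
    omega
  · rw [Set.disjoint_left]
    rintro x (hx | ⟨i, hi⟩) hxC'
    · exact hVC hx (hsub hxC')
    · rcases hpath i x (by simpa using hi) with h | rfl
      · exact h.2 hxC'
      · exact hC'US hxC' (Or.inr ⟨hv i, i.2⟩)
  · obtain ⟨s, hs, hsS, hsC⟩ := hS
    obtain ⟨i, rfl⟩ := hall s hsS
    exact ⟨v i, hs, hF1 ⟨i, hsC⟩ fun h => hVC h hsC⟩

theorem IsComp.exists_extension [Finite α] {G : SimpleGraph α} {U C : Set α} {h k : ℕ}
    (hC : IsComp G U C) (hpre : Premesh G C h) (hk : 1 ≤ k) (hh : 1 ≤ h) :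
    (∃ V X H, IsFrame G X V H ∧ Disjoint V C ∧ X.ncard = h ∧ ∀ Y Z, Y ⊆ X → Z ⊆ X →
      Disjoint Y Z → Y.ncard = k → Z.ncard = k → Linked (restr G C (Y ∪ Z)) Y Z k) ∨
    ∃ S ⊆ C, S.Nonempty ∧ (nbhd G C ∪ S).ncard ≤ h + k - 1 ∧
      ∀ C', IsComp G (U ∪ S) C' → C' ⊆ C → Premesh G C' h := by
  rcases hpre with hN | ⟨hNh, V, H, hF, hVC, x, hx, hx1⟩
  · obtain ⟨c, hc⟩ := hC.1.1
    refine Or.inr ⟨{c}, by simpa using hc, ⟨c, rfl⟩, ?_, fun C' hC' hsub => ?_⟩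
    · rw [hN, Set.empty_union, Set.ncard_singleton]
      omega
    have hN' := hC.nbhd_subset_union hC' hsub
    rw [hN, Set.empty_union] at hN'
    obtain ⟨c', hc', rfl : c' = c⟩ :=
      hC.nbhd_inter_nonempty (S := {c}) (by simpa using hc) ⟨c, rfl⟩ hC' hsub
    have hN' := hN'.antisymm (Set.singleton_subset_iff.2 hc')
    refine Or.inr ⟨by rw [hN', Set.ncard_singleton]; exact hh, {c'}, ⊥, ⟨bot_le, by simp,
      connSet_singleton _ _, hN'.subset, by simp, by simp⟩, ?_, c', hc', by simp⟩
    rw [Set.disjoint_singleton_left]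
    exact hc'.1
  rcases hNh.lt_or_eq with hlt | heq
  · obtain ⟨hxC, c, hc, hcx⟩ := id hx
    refine Or.inr ⟨{c}, by simpa using hc, ⟨c, rfl⟩, ?_, fun C' hC' hsub => ?_⟩
    · have := Set.ncard_union_le (nbhd G C) {c}
      rw [Set.ncard_singleton] at this
      omega
    have hN' := hC.nbhd_subset_union hC' hsub
    have hcV : c ∉ V := fun h => Set.disjoint_left.1 hVC h hc
    obtain ⟨c', hc', rfl : c' = c⟩ :=
      hC.nbhd_inter_nonempty (S := {c}) (by simpa using hc) ⟨c, rfl⟩ hC' hsub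
    obtain ⟨hF', hF1⟩ := hF.attach_paths (ι := Unit) (X' := nbhd G C') (u := fun _ => x)
      (v := fun _ => c') (fun _ => hcx.symm.toWalk) (fun _ => by simp [hcx.ne'])
      (fun _ _ _ _ _ => rfl) (fun _ => hF.subset hx) (fun _ => hx1.trans one_le_two)
      (fun _ z hz hzV => by
        have : z = x ∨ z = c' := by simpa using hz
        exact this.resolve_right fun h => hcV (h ▸ hzV))
      (fun z hz => by
        rcases hN' hz with h | h
        · exact Or.inl ⟨h, fun _ hzx => hzx ▸ hx1⟩
        · exact Or.inr ⟨h ▸ hcV, (), h⟩)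
    refine Or.inr ⟨?_, _, _, hF', ?_, c', hc', hF1 () hcV⟩
    · have h1 := Set.ncard_le_ncard hN'
      have h2 := Set.ncard_union_le (nbhd G C) {c'}
      rw [Set.ncard_singleton] at h2
      omega
    · rw [Set.disjoint_left]
      rintro z (hz | ⟨-, hz⟩) hzC'
      · exact Set.disjoint_left.1 hVC hz (hsub hzC')
      · have : z = x ∨ z = c' := by simpa using hz
        rcases this with rfl | rfl
        exacts [hxC (hsub hzC'), hc'.1 hzC']
  by_cases hmesh : ∀ Y Z, Y ⊆ nbhd G C → Z ⊆ nbhd G C →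
      Disjoint Y Z → Y.ncard = k → Z.ncard = k → Linked (restr G C (Y ∪ Z)) Y Z k
  · exact Or.inl ⟨V, _, H, hF, hVC, heq, hmesh⟩
  push Not at hmesh
  obtain ⟨Y, Z, hY, hZ, -, hYk, hZk, hnl⟩ := hmesh
  obtain ⟨R, hR, hRk⟩ : ∃ R, Separates (restr G C (Y ∪ Z)) Y Z R ∧ R.ncard < k := by
    by_contra! hcon
    exact hnl (menger _ _ _ _ hcon)
  obtain ⟨S, hS, hmin⟩ := (Set.toFinite {R | Separates (restr G C (Y ∪ Z)) Y Z R}).exists_minimalFor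
    Set.ncard _ ⟨R, hR⟩
  have hmin : ∀ R, Separates (restr G C (Y ∪ Z)) Y Z R → S.ncard ≤ R.ncard := fun R hR => by
    by_contra! hlt
    exact absurd (hmin hR hlt.le) (by simpa using hlt)
  have hSk : S.ncard < k := (hmin R hR).trans_lt hRk
  have hSC : (S ∩ C).Nonempty := by
    by_contra hne
    have hCS : Disjoint C S := by
      rw [Set.disjoint_left]
      exact fun a ha haS => hne ⟨a, haS, ha⟩
    have hsub : ∀ Q ⊆ nbhd G C, Q.ncard = k → ¬ ∀ y ∈ Q \ S, ∀ c ∈ C, ¬ G.Adj c y := by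
      intro Q hQ hQk hcon
      obtain ⟨y, hyQ, hyS⟩ := Set.exists_mem_notMem_of_ncard_lt_ncard (hQk ▸ hSk)
      obtain ⟨-, c, hc, hcy⟩ := hQ hyQ
      exact hcon y ⟨hyQ, hyS⟩ c hc hcy
    rcases Separates.forall_not_adj_or hS hC.1 subset_rfl hCS with h | h
    exacts [hsub Y hY hYk h, hsub Z hZ hZk h]
  refine Or.inr ⟨S ∩ C, Set.inter_subset_right, hSC, ?_, fun C' hC' hsub => ?_⟩
  · have h1 := Set.ncard_union_le (nbhd G C) (S ∩ C)
    have h2 : (S ∩ C).ncard ≤ S.ncard := Set.ncard_le_ncard Set.inter_subset_left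
    omega
  have hleaf := hC.nbhd_inter_nonempty Set.inter_subset_right hSC hC' hsub
  have hC'S : Disjoint C' S := by
    rw [Set.disjoint_left]
    exact fun a ha haS => Set.disjoint_left.1 hC'.2.1 ha (Or.inr ⟨haS, hsub ha⟩)
  rcases Separates.forall_not_adj_or hS hC'.1 hsub hC'S with hadj | hadj
  · have hcomm : restr G C (Y ∪ Z) = restr G C (Z ∪ Y) := by rw [Set.union_comm]
    refine hC.premesh_of_separates hF hVC hY (Y := Z) (Z := Y) (S := S) ?_ ?_ (by omega) hNh hC'
      hsub hleaf hadj
    · rw [← hcomm]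
      exact Separates.symm hS
    · intro R hR
      rw [← hcomm] at hR
      exact hmin R hR.symm
  · exact hC.premesh_of_separates hF hVC hZ hS hmin (by omega) hNh hC' hsub hleaf hadj

/-- A graph of large treewidth contains a mesh. -/
theorem exists_mesh {α : Type} [Finite α] (G : SimpleGraph α) {h k : ℕ} (hh : 1 ≤ h)
    (hk : 1 ≤ k) (htw : h + k - 1 ≤ treewidth G) :
    ∃ (C V X : Set α) (H : SimpleGraph α), IsFrame G X V H ∧ Disjoint V C ∧ X.ncard = h ∧
      ∀ Y Z, Y ⊆ X → Z ⊆ X → Disjoint Y Z → Y.ncard = k → Z.ncard = k →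
        Linked (restr G C (Y ∪ Z)) Y Z k := by
  by_contra hcon
  obtain ⟨U, hU, hmax⟩ := (Set.toFinite {U | PartialDecomp G (h + k - 1) h U}).exists_maximal
    ⟨∅, partialDecomp_empty G _ _⟩
  have hne : U ≠ Set.univ := by
    rintro rfl
    obtain ⟨m, hm⟩ : ∃ m, h + k - 1 = m + 1 := ⟨h + k - 2, by omega⟩
    rw [hm] at hU htw
    have := PartialDecomp.treewidth_le hU
    omega
  obtain ⟨x, hx⟩ := (Set.ne_univ_iff_exists_notMem U).1 hne
  obtain ⟨C, -, hC⟩ := exists_isComp G hx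
  obtain ⟨_, _, _, -, -, -, -, -, hpre⟩ := id hU
  rcases hC.exists_extension (hpre C hC).2 hk hh with ⟨V, X, H, hm⟩ | ⟨S, hSC, ⟨s, hs⟩, hcard, hS⟩
  · exact hcon ⟨C, V, X, H, hm⟩
  · have := hmax (PartialDecomp.extend hU hC hSC hcard hS) Set.subset_union_left (Or.inr hs)
    exact Set.disjoint_left.1 hC.2.1 (hSC hs) this

theorem ne_of_mem_support_tail_dropLast {G : SimpleGraph α} {u v z : α} {w : G.Walk u v}
    (hw : w.IsPath) (hz : z ∈ w.support.tail.dropLast) : z ≠ u ∧ z ≠ v := by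
  cases w with
  | nil => simp at hz
  | cons h p =>
    rw [Walk.cons_isPath_iff] at hw
    rw [Walk.support_cons, List.tail_cons] at hz
    refine ⟨fun h => hw.2 (h ▸ List.mem_of_mem_dropLast hz), ?_⟩
    rintro rfl
    have hn := hw.1.support_nodup
    rw [← List.dropLast_append_getLast p.support_ne_nil, List.nodup_append] at hn
    exact hn.2.2 z hz z (by simp) rfl

/-- A linkage of the disjoint sets `Y` and `Z` by paths whose edges have an end in `C` consists of
paths of length at least two with all internal vertices in `C`. -/
theorem Linked.exists_paths_of_restr [Finite α] {G : SimpleGraph α} {C Y Z : Set α} {k : ℕ}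
    (h : Linked (restr G C (Y ∪ Z)) Y Z k) (hC : Disjoint (Y ∪ Z) C) (hYZ : Disjoint Y Z)
    (hY : Y.ncard = k) (hZ : Z.ncard = k) :
    ∃ (u v : Fin k → α) (w : ∀ i, G.Walk (u i) (v i)), (∀ i, u i ∈ Y) ∧ (∀ i, v i ∈ Z) ∧
      (∀ i, (w i).IsPath) ∧ (∀ i, 2 ≤ (w i).length) ∧
      (∀ i j z, z ∈ (w i).support → z ∈ (w j).support → i = j) ∧
      ∀ i, ∀ z ∈ (w i).support.tail.dropLast, z ∈ C := by
  obtain ⟨u, v, w, hu, hv, hw, hd⟩ := h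
  rw [Set.disjoint_left] at hC hYZ
  have hendZ := (exists_end_eq hv hd hZ.le).2
  have hendY := (exists_end_eq (w := fun i => (w i).reverse) hu
    (fun i j z hi hj => hd i j z (by simpa using hi) (by simpa using hj)) hY.le).2
  refine ⟨u, v, fun i => (w i).mapLe (restr_le G C _), hu, hv, fun i => (hw i).mapLe _,
    fun i => ?_, fun i j z hi hj => hd i j z (by simpa using hi) (by simpa using hj),
    fun i z hz => ?_⟩
  · rw [Walk.length_mapLe]
    by_contra! hlt
    have hcases : (w i).length = 0 ∨ (w i).length = 1 := by omega
    rcases hcases with h0 | h1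
    · exact hYZ (hu i) (Walk.eq_of_length_eq_zero h0 ▸ hv i)
    · rcases (Walk.adj_of_length_eq_one h1).2.2.2 with h | h
      exacts [hC (Or.inl (hu i)) h, hC (Or.inr (hv i)) h]
  · rw [Walk.support_mapLe_eq_support] at hz
    obtain ⟨hzu, hzv⟩ := ne_of_mem_support_tail_dropLast (hw i) hz
    have hzw : z ∈ (w i).support := List.mem_of_mem_tail (List.mem_of_mem_dropLast hz)
    rcases mem_of_mem_support_restr (w i) (Or.inr (Or.inl (hu i))) z hzw with h | h | h
    · exact h
    · exact (hzu (hendY i z (by simpa using hzw) h)).elim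
    · exact (hzv (hendZ i z hzw h)).elim

theorem ncard_iUnion_eq_mul [Finite α] {n p : ℕ} {X : Fin n → Set α}
    (hX : Pairwise fun i j => Disjoint (X i) (X j)) (hp : ∀ i, (X i).ncard = p) :
    (⋃ i, X i).ncard = p * n := by
  rw [Set.ncard_iUnion_of_finite (fun i => Set.toFinite _) hX, finsum_eq_sum_of_fintype]
  simp [hp, mul_comm]

end

/-- If `tw(G) ≥ 5pq − 2q + 2p − 1` (with `p ≥ q ≥ 1`), then there
exist `2q` pairwise disjoint sets `X_1, …, X_{2q}`, each of size `p`, connected by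
pairwise disjoint trees with vertices in a set `A`, together with `pq` pairwise
vertex-disjoint paths of length at least `2`, each having one end in some `X_i`
with `i ≤ q`, the other end in some `X_j` with `j > q`, and no internal vertex in
`A` or in any `X_l`. -/
theorem good_mesh {α : Type} [Fintype α] (G : SimpleGraph α) (p q : ℕ)
    (hq : 1 ≤ q) (hpq : q ≤ p)
    (htw : 5 * p * q - 2 * q + 2 * p - 1 ≤ treewidth G) :
    ∃ (X : Fin (2 * q) → Set α) (A : Set α) (T : Fin (2 * q) → G.Subgraph)
      (P : Fin (p * q) → Σ u : α, Σ v : α, G.Walk u v),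
      (Pairwise fun i j => Disjoint (X i) (X j)) ∧
      (∀ i, (X i).ncard = p) ∧
      (∀ i, (T i).coe.IsTree) ∧
      (∀ i, (T i).verts ⊆ A) ∧
      (∀ i, X i ⊆ (T i).verts) ∧
      (Pairwise fun i j => Disjoint (T i).verts (T j).verts) ∧
      (∀ m, (P m).2.2.IsPath) ∧
      (∀ m, 2 ≤ (P m).2.2.length) ∧
      (Pairwise fun m m' => ∀ v, v ∈ (P m).2.2.support → v ∉ (P m').2.2.support) ∧
      (∀ m, ∃ i j : Fin (2 * q), (i : ℕ) < q ∧ q ≤ (j : ℕ) ∧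
        (P m).1 ∈ X i ∧ (P m).2.1 ∈ X j) ∧
      (∀ m, ∀ v ∈ (P m).2.2.support.tail.dropLast, v ∉ A ∧ ∀ l, v ∉ X l) := by
  have hp : 1 ≤ p := hq.trans hpq
  have hqpq : q ≤ p * q := Nat.le_mul_of_pos_left q hp
  obtain ⟨C, V, S, H, hF, hVC, hS, hlink⟩ := exists_mesh G (h := 4 * (p * q) - 2 * q + 2 * p)
    (k := p * q) (by omega) (by omega) (by rw [mul_assoc] at htw; omega)
  obtain ⟨W, hWV, hWc, hWp, hWd⟩ : ∃ W : Fin (2 * q) → Set α, (∀ i, W i ⊆ V) ∧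
      (∀ i, ConnSet H (W i)) ∧ (∀ i, p ≤ (W i ∩ S).ncard) ∧
      Pairwise fun i j => Disjoint (W i) (W j) := by
    obtain ⟨n, hn⟩ : ∃ n, 2 * q = n + 1 := ⟨2 * q - 1, by omega⟩
    rw [hn]
    refine hF.conn.exists_pieces S hF.deg_le hp n V ?_
    rw [Set.inter_eq_right.2 hF.subset, hS]
    obtain ⟨p, rfl⟩ := Nat.exists_eq_add_of_le' hp
    obtain ⟨q, rfl⟩ := Nat.exists_eq_add_of_le' hq
    obtain rfl : n = 2 * q + 1 := by omega
    have h1 : 2 * (p + 1) - 1 = 2 * p + 1 := by omega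
    have h2 : 4 * ((p + 1) * (q + 1)) - 2 * (q + 1) = 4 * (p * q) + 4 * p + 2 * q + 2 := by
      rw [Nat.sub_eq_iff_eq_add (by nlinarith)]
      ring
    rw [h1, h2]
    nlinarith
  choose X hXW hXp using fun i => Set.exists_subset_card_eq (hWp i)
  choose T hTW hT using fun i => ((hWc i).mono hF.le).exists_spanning_tree
  have hXS : ∀ i, X i ⊆ S := fun i => (hXW i).trans Set.inter_subset_right
  have hX : Pairwise fun i j => Disjoint (X i) (X j) := fun i j hij =>
    (hWd hij).mono ((hXW i).trans Set.inter_subset_left) ((hXW j).trans Set.inter_subset_left)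
  have hXC : ∀ i, Disjoint (X i) C := fun i => hVC.mono_left ((hXS i).trans hF.subset)
  let l : Fin q → Fin (2 * q) := fun i => ⟨i, by omega⟩
  let r : Fin q → Fin (2 * q) := fun i => ⟨q + i, by omega⟩
  have hl : Function.Injective l := fun i j hij => Fin.ext (by simpa [l] using hij)
  have hr : Function.Injective r := fun i j hij => Fin.ext (by simpa [r] using hij)
  have hY := ncard_iUnion_eq_mul (X := fun i => X (l i)) (fun i j hij => hX (hl.ne hij))
    fun i => hXp _
  have hZ := ncard_iUnion_eq_mul (X := fun i => X (r i)) (fun i j hij => hX (hr.ne hij))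
    fun i => hXp _
  have hYZ : Disjoint (⋃ i, X (l i)) (⋃ i, X (r i)) := by
    simp only [Set.disjoint_iUnion_left, Set.disjoint_iUnion_right]
    intro i j
    refine hX fun h => ?_
    have := Fin.ext_iff.1 h
    simp only [l, r] at this
    omega
  have hYZC : Disjoint ((⋃ i, X (l i)) ∪ ⋃ i, X (r i)) C := by
    simp only [Set.disjoint_union_left, Set.disjoint_iUnion_left]
    exact ⟨fun i => hXC _, fun i => hXC _⟩
  obtain ⟨u, v, w, hu, hv, hw, hlen, hd, hint⟩ := (hlink _ _ (Set.iUnion_subset fun i => hXS _)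
    (Set.iUnion_subset fun i => hXS _) hYZ hY hZ).exists_paths_of_restr hYZC hYZ hY hZ
  refine ⟨X, Cᶜ, T, fun m => ⟨u m, v m, w m⟩, hX, hXp, hT, fun i => ?_, fun i => ?_,
    fun i j hij => ?_, hw, hlen, fun i j hij z hi hj => hij (hd i j z hi hj), fun m => ?_,
    fun m z hz => ⟨not_not.2 (hint m z hz), fun i hi => Set.disjoint_left.1 (hXC i) hi
      (hint m z hz)⟩⟩
  · rw [hTW]
    exact Set.subset_compl_iff_disjoint_right.2 (hVC.mono_left (hWV i))
  · rw [hTW]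
    exact (hXW i).trans Set.inter_subset_left
  · simp only [hTW]
    exact hWd hij
  · obtain ⟨i, hi⟩ := Set.mem_iUnion.1 (hu m)
    obtain ⟨j, hj⟩ := Set.mem_iUnion.1 (hv m)
    exact ⟨l i, r j, i.2, Nat.le_add_right q j, hi, hj⟩
end

section
/- Let T be a finite tree of maximum degree at most 3 and let X = {v ∈ V(T) : deg_T(v) ≤ 2}. Then for every path P in T, there is a partition M of V(T) such that every vertex of P belongs to a different element of M, every vertex of P belongs to some element of M, and every element of M contains at least one element of X. -/
open SimpleGraph

open Classical in
/-- A path in a tree of maximum degree at most `3` has at most as many vertices as the tree has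
vertices of degree at most `2`. -/
theorem card_path_support_le_card_degree_le_two {α : Type*} [Fintype α] {T : SimpleGraph α}
    (hT : T.IsTree) (hdeg : ∀ v : α, T.degree v ≤ 3)
    {u v : α} {P : T.Walk u v} (hP : P.IsPath) :
    P.support.toFinset.card ≤ (Finset.univ.filter fun x => T.degree x ≤ 2).card := by
  have pos_of_ne {x y : α} (hxy : x ≠ y) : 1 ≤ T.degree x := by
    have : Nontrivial α := ⟨x, y, hxy⟩
    exact hT.connected.preconnected.degree_pos_of_nontrivial x
  have local_bound : ∀ x : α, (if x ∈ P.support then 1 else 0) + 2 ≤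
      (if T.degree x ≤ 2 then 1 else 0) + T.degree x +
        ((if x = u then 1 else 0) + (if x = v then 1 else 0)) := by
    intro x
    have h3 := hdeg x
    by_cases hx : x ∈ P.support
    · have key : 2 ≤ T.degree x + ((if x = u then 1 else 0) + (if x = v then 1 else 0)) := by
        by_cases hxu : x = u
        · by_cases hxv : x = v
          · simp [hxu ▸ hxv, hxu]
          · have := pos_of_ne hxv
            simp only [if_pos hxu, if_neg hxv]
            omega
        · by_cases hxv : x = v
          · have := pos_of_ne hxu
            simp only [if_neg hxu, if_pos hxv]
            omega
          · obtain ⟨i, rfl, hi⟩ := Walk.mem_support_iff_exists_getVert.mp hx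
            have hi0 : i ≠ 0 := by rintro rfl; simp at hxu
            have hil : i ≠ P.length := by rintro rfl; simp at hxv
            have h2 := hP.ncard_neighborSet_toSubgraph_internal_eq_two hi0 (by omega)
            have hle := Set.ncard_le_ncard (P.toSubgraph.neighborSet_subset (P.getVert i))
              (Set.toFinite _)
            rw [h2, Set.ncard_eq_toFinset_card'] at hle
            exact hle.trans (Nat.le_add_right _ _)
      rw [if_pos hx]
      by_cases h2 : T.degree x ≤ 2
      · rw [if_pos h2]; omega
      · omega
    · have := pos_of_ne (x := x) (y := u) (by rintro rfl; exact hx P.start_mem_support)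
      rw [if_neg hx]
      by_cases h2 : T.degree x ≤ 2
      · rw [if_pos h2]; omega
      · omega
  have hsum := Finset.sum_le_sum fun x (_ : x ∈ Finset.univ) => local_bound x
  simp only [Finset.sum_add_distrib, Finset.sum_ite_eq', Finset.mem_univ, if_true,
    Finset.sum_const, Finset.card_univ, smul_eq_mul, T.sum_degrees_eq_twice_card_edges,
    ← Finset.card_filter] at hsum
  have hedge := hT.card_edgeFinset
  have hfilter : (Finset.univ.filter fun x => x ∈ P.support) = P.support.toFinset := by
    ext; simp
  rw [hfilter] at hsum
  omega

/-- If `A` and `X` are finite sets with `|A| ≤ |X|`, some partition of the ambient type has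
every part meeting `X` and no part containing two elements of `A`. -/
theorem exists_isPartition_of_card_le {α : Type*} [DecidableEq α] {A X : Finset α}
    (hcard : A.card ≤ X.card) (hX : X.Nonempty) :
    ∃ M : Set (Set α), Setoid.IsPartition M ∧
      (∀ S ∈ M, ∀ x ∈ A, ∀ y ∈ A, x ∈ S → y ∈ S → x = y) ∧
      (∀ S ∈ M, ∃ x ∈ S, x ∈ X) := by
  obtain ⟨c, hc⟩ := hX
  have hdiff : (A \ X).card ≤ (X \ A).card := by
    have h1 := Finset.card_sdiff_add_card_inter A X
    have h2 := Finset.card_sdiff_add_card_inter X A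
    rw [Finset.inter_comm] at h2
    omega
  obtain ⟨e⟩ : Nonempty ((A \ X : Finset α) ↪ (X \ A : Finset α)) :=
    Function.Embedding.nonempty_of_card_le (by simpa using hdiff)
  let g : α → α := fun x => if x ∈ X then x else if h : x ∈ A \ X then e ⟨x, h⟩ else c
  have hgX : ∀ x ∈ X, g x = x := fun x hx => if_pos hx
  have hgA : ∀ x (h : x ∈ A \ X), g x = e ⟨x, h⟩ := fun x h => by
    simp only [g, if_neg (Finset.mem_sdiff.mp h).2, dif_pos h]
  have hg : ∀ x, g x ∈ X := by
    intro x
    by_cases hx : x ∈ X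
    · rwa [hgX x hx]
    by_cases h : x ∈ A \ X
    · rw [hgA x h]
      exact (Finset.mem_sdiff.mp (e ⟨x, h⟩).2).1
    · simpa only [g, if_neg hx, dif_neg h] using hc
  have hinj : ∀ x ∈ A, ∀ y ∈ A, g x = g y → x = y := by
    intro x hx y hy hxy
    by_cases hxX : x ∈ X <;> by_cases hyX : y ∈ X
    · rwa [hgX x hxX, hgX y hyX] at hxy
    · have h : y ∈ A \ X := Finset.mem_sdiff.mpr ⟨hy, hyX⟩
      rw [hgX x hxX, hgA y h] at hxy
      exact absurd (hxy ▸ hx) (Finset.mem_sdiff.mp (e ⟨y, h⟩).2).2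
    · have h : x ∈ A \ X := Finset.mem_sdiff.mpr ⟨hx, hxX⟩
      rw [hgX y hyX, hgA x h] at hxy
      exact absurd (hxy ▸ hy) (Finset.mem_sdiff.mp (e ⟨x, h⟩).2).2
    · rw [hgA x (Finset.mem_sdiff.mpr ⟨hx, hxX⟩), hgA y (Finset.mem_sdiff.mpr ⟨hy, hyX⟩)] at hxy
      exact congrArg Subtype.val (e.injective (Subtype.ext hxy))
  refine ⟨(Setoid.ker g).classes, Setoid.isPartition_classes _, ?_, ?_⟩
  · rintro S ⟨z, rfl⟩ x hx y hy (hxz : g x = g z) (hyz : g y = g z)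
    exact hinj x hx y hy (hxz.trans hyz.symm)
  · rintro S ⟨z, rfl⟩
    exact ⟨g z, hgX _ (hg z), hg z⟩

/-- Let `T` be a finite tree of maximum degree at most `3` and
`X = {v : deg_T(v) ≤ 2}`. For every path `P` in `T` there is a partition `M` of
`V(T)` such that distinct vertices of `P` lie in distinct elements of `M` and
every element of `M` contains an element of `X`. -/
theorem tree_path_partition {α : Type} [Fintype α] (T : SimpleGraph α)
    (hT : T.IsTree) (hdeg : ∀ v : α, (T.neighborSet v).ncard ≤ 3)
    (u v : α) (P : T.Walk u v) (hP : P.IsPath) :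
    ∃ M : Set (Set α), Setoid.IsPartition M ∧
      (∀ S ∈ M, ∀ x ∈ P.support, ∀ y ∈ P.support, x ∈ S → y ∈ S → x = y) ∧
      (∀ S ∈ M, ∃ x ∈ S, (T.neighborSet x).ncard ≤ 2) := by
  classical
  have hncard : ∀ x, (T.neighborSet x).ncard = T.degree x := fun x =>
    Set.ncard_eq_toFinset_card' _
  simp only [hncard] at hdeg ⊢
  have hcard := card_path_support_le_card_degree_le_two hT hdeg hP
  have hne : (Finset.univ.filter fun x => T.degree x ≤ 2).Nonempty :=
    Finset.card_pos.mp <| (Finset.card_pos.mpr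
      ⟨u, List.mem_toFinset.mpr P.start_mem_support⟩).trans_le hcard
  simpa using exists_isPartition_of_card_le hcard hne
end

section
/- For every finite graph G on n vertices, if the pathwidth of G is at most 2, then G is a minor of the graph Ξ_n. -/
open SimpleGraph

/-- Two rows of slots, each filled initially by `0` and changed at time `k + 1` only by inserting
the newcomer `k + 1`, suffice to store the active indices `A` at all times, provided that at most
two indices are active at a time and that only the newcomer can become active. -/
theorem exists_two_rows (A : ℕ → ℕ → Prop) (hzero : ∀ j, ¬ A 0 j)
    (hsucc : ∀ k j, A (k + 1) j → A k j ∨ j = k)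
    (htwo : ∀ k i j l, A k i → A k j → A k l → i = j ∨ i = l ∨ j = l) :
    ∃ x z : ℕ → ℕ, x 0 = 0 ∧ z 0 = 0 ∧
      (∀ k, x (k + 1) = x k ∨ x (k + 1) = k + 1) ∧
      (∀ k, z (k + 1) = z k ∨ z (k + 1) = k + 1) ∧
      ∀ k j, A (k + 1) j → j = x k ∨ j = z k := by
  classical
  let s : ℕ → ℕ × ℕ := fun k => Nat.rec (0, 0) (fun k p =>
    if A (k + 2) (k + 1) then
      if A (k + 2) p.1 ∧ p.1 ≠ p.2 then (p.1, k + 1) else (k + 1, p.2)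
    else p) k
  have hs : ∀ k, s (k + 1) =
      if A (k + 2) (k + 1) then
        if A (k + 2) (s k).1 ∧ (s k).1 ≠ (s k).2 then ((s k).1, k + 1) else (k + 1, (s k).2)
      else s k := fun _ => rfl
  have hle : ∀ k, (s k).1 ≤ k := by
    intro k
    induction k with
    | zero => exact le_rfl
    | succ k ih => rw [hs]; split_ifs <;> grind
  refine ⟨fun k => (s k).1, fun k => (s k).2, rfl, rfl, fun k => ?_, fun k => ?_, fun k => ?_⟩
  · simp only [hs]; split_ifs <;> simp
  · simp only [hs]; split_ifs <;> simp
  · induction k with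
    | zero =>
      intro j hj
      exact Or.inl ((hsucc 0 j hj).resolve_left (hzero j))
    | succ k ih =>
      intro j hj
      have hj' := hsucc _ _ hj
      have hjk := ih j
      have hk := hle k
      simp only [hs]
      clear_value s
      split_ifs with hnew hkeep
      · have := htwo _ _ _ _ hj hnew hkeep.1
        simp only
        omega
      · grind
      · grind

/-- A vertex set inducing a connected subgraph of a path is an interval. -/
theorem ordConnected_of_connected_induce_pathGraph {m : ℕ} {S : Set (Fin m)}
    (hS : ((pathGraph m).induce S).Connected) : S.OrdConnected := by
  refine ⟨fun a ha b hb c hc => ?_⟩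
  by_contra hcS
  have key : ∀ u v : S, ((pathGraph m).induce S).Walk u v → u.1 < c → v.1 < c := by
    intro u v p
    induction p with
    | nil => exact id
    | @cons u v w huv p ih =>
      intro hu
      apply ih
      have hv : v.1 ≠ c := fun h => hcS (h ▸ v.2)
      have : u.1.1 + 1 = v.1.1 ∨ v.1.1 + 1 = u.1.1 := pathGraph_adj.1 huv
      rw [Fin.lt_def] at hu ⊢
      rw [ne_eq, Fin.ext_iff] at hv
      omega
  obtain ⟨p⟩ := hS.preconnected ⟨a, ha⟩ ⟨b, hb⟩
  have hac : a < c := lt_of_le_of_ne hc.1 fun h => hcS (h ▸ ha)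
  exact absurd (key _ _ p hac) (not_lt.2 hc.2)

/-- A finite graph has a path decomposition of width at most its pathwidth. -/
theorem exists_pathDecomp_of_pathwidth_le {α : Type*} [Finite α] {G : SimpleGraph α} {w : ℕ}
    (hw : pathwidth G ≤ w) :
    ∃ (m : ℕ) (X : Fin (m + 1) → Set α),
      IsTreeDecomp G (pathGraph (m + 1)) X ∧ ∀ t, (X t).ncard ≤ w + 1 := by
  have hne : {w | ∃ (n : ℕ) (X : Fin (n + 1) → Set α),
      IsTreeDecomp G (pathGraph (n + 1)) X ∧ ∀ t, (X t).ncard ≤ w + 1}.Nonempty := by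
    refine ⟨(Set.univ : Set α).ncard, 0, fun _ => Set.univ, ⟨by simp, by simp, fun v => ?_⟩,
      fun _ => Nat.le_succ _⟩
    have : Nonempty ({t | v ∈ (Set.univ : Set α)} : Set (Fin 1)) := ⟨⟨0, Set.mem_univ v⟩⟩
    exact ⟨fun a b => by
      obtain rfl : a = b := Subtype.ext (Subsingleton.elim (α := Fin 1) _ _)
      exact Reachable.refl _⟩
  obtain ⟨m, X, hX, hcard⟩ := Nat.sInf_mem hne
  exact ⟨m, X, hX, fun t => (hcard t).trans (Nat.succ_le_succ hw)⟩

/-- The vertices of a graph with a path decomposition of width at most `2` can be enumerated such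
that, for a suitable notion of activity, every earlier neighbour of the `k`-th vertex is active at
time `k`, at most two indices are active at a time, and only the newcomer can become active. -/
theorem exists_enumeration_of_pathDecomp {α : Type*} [Fintype α] {G : SimpleGraph α} {m : ℕ}
    {X : Fin (m + 1) → Set α} (hX : IsTreeDecomp G (pathGraph (m + 1)) X)
    (hcard : ∀ t, (X t).ncard ≤ 3) :
    ∃ (e : Fin (Fintype.card α) ≃ α) (A : ℕ → ℕ → Prop), (∀ j, ¬ A 0 j) ∧
      (∀ k j, A (k + 1) j → A k j ∨ j = k) ∧
      (∀ k i j l, A k i → A k j → A k l → i = j ∨ i = l ∨ j = l) ∧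
      ∀ j k, j < k → G.Adj (e j) (e k) → A k j := by
  classical
  obtain ⟨hmem, hadj, hconn⟩ := hX
  have hleast : ∀ v, ∃ t, v ∈ X t ∧ ∀ s, v ∈ X s → t ≤ s := by
    intro v
    obtain ⟨t, ht, hmin⟩ := (Set.toFinite {t | v ∈ X t}).exists_minimal (hmem v)
    exact ⟨t, ht, fun s hs => (le_total t s).elim id fun h => hmin hs h⟩
  choose l hl hlmin using hleast
  let e₀ := (Fintype.equivFin α).symm
  let e := (Tuple.sort (l ∘ e₀)).trans e₀
  have hmono : Monotone fun i => l (e i) := Tuple.monotone_sort (l ∘ e₀)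
  refine ⟨e, fun k j => ∃ (hj : j < Fintype.card α) (hk : k < Fintype.card α), j < k ∧
    ∃ t, l (e ⟨k, hk⟩) ≤ t ∧ e ⟨j, hj⟩ ∈ X t, ?_, ?_, ?_, ?_⟩
  · rintro j ⟨-, -, h, -⟩
    exact absurd h (Nat.not_lt_zero j)
  · rintro k j ⟨hj, hk, hjk, t, ht, hjt⟩
    refine or_iff_not_imp_right.2 fun hne => ⟨hj, by omega, by omega, t, le_trans ?_ ht, hjt⟩
    exact hmono (Fin.mk_le_mk.2 k.le_succ)
  · have hbag : ∀ k j (hj : j < Fintype.card α) (hk : k < Fintype.card α), j < k →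
        (∃ t, l (e ⟨k, hk⟩) ≤ t ∧ e ⟨j, hj⟩ ∈ X t) → e ⟨j, hj⟩ ∈ X (l (e ⟨k, hk⟩)) := by
      rintro k j hj hk hjk ⟨t, ht, hjt⟩
      exact (ordConnected_of_connected_induce_pathGraph (hconn (e ⟨j, hj⟩))).out (hl _) hjt
        ⟨hmono (Fin.mk_le_mk.2 hjk.le), ht⟩
    rintro k a b c ⟨ha, hk, hak, hat⟩ ⟨hb, _, hbk, hbt⟩ ⟨hc, _, hck, hct⟩
    by_contra hne
    simp only [not_or] at hne
    obtain ⟨hab, hac, hbc⟩ := hne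
    let S : Finset α := {e ⟨a, ha⟩, e ⟨b, hb⟩, e ⟨c, hc⟩, e ⟨k, hk⟩}
    have hS : S.card = 4 := by
      simp only [S]
      rw [Finset.card_insert_of_notMem, Finset.card_insert_of_notMem, Finset.card_pair] <;>
        simp [e.injective.eq_iff] <;> omega
    have hsub : (S : Set α) ⊆ X (l (e ⟨k, hk⟩)) := by
      intro v hv
      simp only [S, Finset.coe_insert, Finset.coe_singleton, Set.mem_insert_iff,
        Set.mem_singleton_iff] at hv
      rcases hv with rfl | rfl | rfl | rfl
      · exact hbag k a ha hk hak hat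
      · exact hbag k b hb hk hbk hbt
      · exact hbag k c hc hk hck hct
      · exact hl _
    have := Set.ncard_le_ncard hsub (Set.toFinite _)
    rw [Set.ncard_coe_finset, hS] at this
    have := hcard (l (e ⟨k, hk⟩))
    omega
  · intro j k hjk h
    obtain ⟨t, hjt, hkt⟩ := hadj _ _ h
    exact ⟨j.2, k.2, hjk, t, hlmin _ _ hkt, hjt⟩

/-- In a row of slots changed only by inserting newcomers, every index stored at time `k` was
inserted at some time `j ≤ k` and has stayed there since; hence a set containing the row's slots
for the index `j`, and the `j`-th middle vertex adjacent to the row, links them. -/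
theorem reachable_of_row {V : Type*} {H : SimpleGraph V} {n : ℕ} {r : ℕ → ℕ} (hr0 : r 0 = 0)
    (hr : ∀ k, r (k + 1) = r k ∨ r (k + 1) = k + 1) {p q : Fin n → V}
    (hpp : ∀ i j : Fin n, (j : ℕ) = i + 1 → H.Adj (p i) (p j)) (hpq : ∀ i, H.Adj (p i) (q i))
    {S : Set V} {j : Fin n} (hp : ∀ i : Fin n, r i = j → p i ∈ S) (hq : q j ∈ S) :
    ∀ (k : ℕ) (hk : k < n) (hkj : r k = j),
      (H.induce S).Reachable ⟨p ⟨k, hk⟩, hp ⟨k, hk⟩ hkj⟩ ⟨q j, hq⟩ := by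
  intro k
  induction k with
  | zero =>
    intro hk hkj
    obtain rfl : (⟨0, hk⟩ : Fin n) = j := Fin.ext (hr0.symm.trans hkj)
    exact Adj.reachable (hpq _)
  | succ k ih =>
    intro hk hkj
    rcases hr k with h | h
    · refine Reachable.trans (Adj.reachable ?_) (ih (by omega) (h.symm.trans hkj))
      exact (hpp ⟨k, by omega⟩ ⟨k + 1, hk⟩ rfl).symm
    · obtain rfl : (⟨k + 1, hk⟩ : Fin n) = j := Fin.ext (h.symm.trans hkj)
      exact Adj.reachable (hpq _)

theorem Xi_adj_row {n : ℕ} {c : Fin 3} (hc : c ≠ 1) {i j : Fin n} (h : (j : ℕ) = i + 1) :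
    (Xi n).Adj (c, i) (c, j) := by
  have hij : i ≠ j := by rintro rfl; omega
  rw [Xi, fromRel_adj]
  fin_cases c <;> simp_all

theorem Xi_adj_middle {n : ℕ} {c : Fin 3} (hc : c ≠ 1) (i : Fin n) :
    (Xi n).Adj (c, i) (1, i) := by
  rw [Xi, fromRel_adj]
  fin_cases c <;> simp_all

/-- Every finite graph `G` on `n` vertices of pathwidth at most `2`
is a minor of the graph `Ξ_n`. -/
theorem pw2_minor_of_Xi {α : Type} [Fintype α] (G : SimpleGraph α)
    (hpw : pathwidth G ≤ 2) :
    IsMinor G (Xi (Fintype.card α)) := by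
  obtain ⟨m, X, hX, hcard⟩ := exists_pathDecomp_of_pathwidth_le hpw
  obtain ⟨e, A, hzero, hsucc, htwo, hadj⟩ := exists_enumeration_of_pathDecomp hX hcard
  obtain ⟨x, z, hx0, hz0, hx, hz, hA⟩ := exists_two_rows A hzero hsucc htwo
  let row : Fin 3 → ℕ → ℕ := ![x, id, z]
  have hrow0 : ∀ c, row c 0 = 0 := by
    intro c; fin_cases c <;> simp [row, hx0, hz0]
  have hrow : ∀ c, c ≠ 1 → ∀ k, row c (k + 1) = row c k ∨ row c (k + 1) = k + 1 := by
    intro c hc; fin_cases c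
    · exact hx
    · exact absurd rfl hc
    · exact hz
  let B : α → Set (Fin 3 × Fin (Fintype.card α)) := fun v => {p | row p.1 p.2 = e.symm v}
  have hedge : ∀ j k, j < k → G.Adj (e j) (e k) →
      ∃ a ∈ B (e j), ∃ b ∈ B (e k), (Xi (Fintype.card α)).Adj a b := by
    rintro j ⟨k, hk⟩ hjk h
    obtain _ | k := k
    · exact absurd hjk (Nat.not_lt_zero _)
    obtain ⟨c, hc, hcj⟩ : ∃ c, c ≠ 1 ∧ row c k = j := by
      rcases hA k j (hadj _ _ hjk h) with h | h
      · exact ⟨0, by decide, h.symm⟩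
      · exact ⟨2, by decide, h.symm⟩
    rcases hrow c hc k with h | h
    · exact ⟨(c, ⟨k + 1, hk⟩), by simp [B, h, hcj], (1, ⟨k + 1, hk⟩), by simp [B, row],
        Xi_adj_middle hc _⟩
    · exact ⟨(c, ⟨k, by omega⟩), by simp [B, hcj], (c, ⟨k + 1, hk⟩), by simp [B, h],
        Xi_adj_row hc rfl⟩
  refine ⟨B, fun v => ?_, fun u v huv => ?_, fun u v huv => ?_⟩
  · have hv : ((1 : Fin 3), e.symm v) ∈ B v := rfl
    rw [connected_iff_exists_forall_reachable]
    refine ⟨⟨_, hv⟩, ?_⟩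
    rintro ⟨⟨c, i⟩, hi⟩
    by_cases hc : c = 1
    · subst hc
      obtain rfl : i = e.symm v := Fin.ext hi
      exact Reachable.refl _
    · exact (reachable_of_row (p := fun i => (c, i)) (q := fun i => (1, i)) (hrow0 c) (hrow c hc)
        (fun _ _ => Xi_adj_row hc) (Xi_adj_middle hc) (fun _ h => h) hv i i.2 hi).symm
  · refine Set.disjoint_left.2 fun p hu hv => huv (e.symm.injective (Fin.ext ?_))
    exact Eq.trans (Eq.symm hu) hv
  · rcases lt_trichotomy (e.symm u) (e.symm v) with h | h | h
    · simpa using hedge _ _ h (by simpa using huv)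
    · exact absurd (e.symm.injective h) huv.ne
    · obtain ⟨a, ha, b, hb, hab⟩ := hedge _ _ h (by simpa using huv.symm)
      exact ⟨b, by simpa using hb, a, by simpa using ha, hab.symm⟩
end
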